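/- arXiv:2303.04152 — 2 statements merged into one kernel-verified Lean document; each statement's English description precedes it below -/
import Mathlib

section
/- Let m ≥ 2 and let n_2 be an integer with 1 ≤ n_2 ≤ 2m − 2. Alice has a winning strategy in the achievement game (K_{1,m}, K_{2m-2, n_2}, +) if and only if n_2 ≥ m. -/
namespace AchievementGame

/-- A strategy for the achievement game: given the history of all moves played so far
(earliest first), produce the next move (an edge, i.e. an element of `Sym2`). -/
def Strategy (α : Type*) : Type _ := List (Sym2 α) → Sym2 α

/-- A strategy is valid for the host graph `G` if, whenever some edge of `G` is still
uncolored, it chooses an uncolored edge of `G`. -/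
def Strategy.Valid {α : Type*} (G : SimpleGraph α) (s : Strategy α) : Prop :=
  ∀ l : List (Sym2 α), (∃ e ∈ G.edgeSet, e ∉ l) → s l ∈ G.edgeSet ∧ s l ∉ l

/-- The history of the first `n` moves when Alice plays strategy `σ` and Bob plays
strategy `τ`; Alice moves first and the players alternate. -/
def hist {α : Type*} (σ τ : Strategy α) : ℕ → List (Sym2 α)
  | 0 => []
  | n + 1 => hist σ τ n ++ [(if n % 2 = 0 then σ else τ) (hist σ τ n)]

/-- The `n`-th move (0-indexed): even indices are Alice's (blue) moves,
odd indices are Bob's (red) moves. -/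
def move {α : Type*} (σ τ : Strategy α) (n : ℕ) : Sym2 α :=
  (if n % 2 = 0 then σ else τ) (hist σ τ n)

/-- The set `s` of edges contains a copy of the graph `F`. -/
def HasCopy {α β : Type*} (F : SimpleGraph β) (s : Set (Sym2 α)) : Prop :=
  ∃ f : β ↪ α, ∀ a b, F.Adj a b → s(f a, f b) ∈ s

/-- Alice has a winning strategy in the achievement game `(F, G, +)`: Alice has a valid
strategy such that against every valid strategy of Bob, at some legal move of Alice
(her `(k+1)`-st move, which exists since `2k+1 ≤ |E(G)|`) the blue edges contain a copy
of `F`, while the red edges played strictly before do not. -/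
def AliceWins {α β : Type*} (F : SimpleGraph β) (G : SimpleGraph α) : Prop :=
  ∃ σ : Strategy α, Strategy.Valid G σ ∧ ∀ τ : Strategy α, Strategy.Valid G τ →
    ∃ k : ℕ, 2 * k + 1 ≤ G.edgeSet.ncard ∧
      HasCopy F {e | ∃ i ≤ k, e = move σ τ (2 * i)} ∧
      ¬ HasCopy F {e | ∃ i < k, e = move σ τ (2 * i + 1)}

/-- The matching `mK₂` consisting of `m` pairwise disjoint edges. -/
def matching (m : ℕ) : SimpleGraph (Fin m ⊕ Fin m) :=
  SimpleGraph.fromRel (fun a b => ∃ i, a = Sum.inl i ∧ b = Sum.inr i)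

/-- The star `K_{1,m}`: the center `0` joined to `m` leaves. -/
def star (m : ℕ) : SimpleGraph (Fin (m + 1)) :=
  SimpleGraph.fromRel (fun a _ => a = 0)

/-- The double star `S_{m,n}`: disjoint stars `K_{1,m}` and `K_{1,n}` with an edge
joining their centers `Sum.inl 0` and `Sum.inr 0`. -/
def doubleStar (m n : ℕ) : SimpleGraph (Fin (m + 1) ⊕ Fin (n + 1)) :=
  SimpleGraph.fromRel (fun a b =>
    (a = Sum.inl 0 ∧ ∃ i, b = Sum.inl i) ∨
    (a = Sum.inr 0 ∧ ∃ j, b = Sum.inr j) ∨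
    (a = Sum.inl 0 ∧ b = Sum.inr 0))

/-- The disjoint union `K_{1,m} ∪ nK₂` of a star and a matching. -/
def starMatching (m n : ℕ) : SimpleGraph (Fin (m + 1) ⊕ (Fin n ⊕ Fin n)) :=
  SimpleGraph.fromRel (fun a b =>
    (a = Sum.inl 0 ∧ ∃ i, b = Sum.inl i) ∨
    (∃ i, a = Sum.inr (Sum.inl i) ∧ b = Sum.inr (Sum.inr i)))

end AchievementGame

open AchievementGame


namespace StarProof

set_option linter.unusedSectionVars false

section Game
variable {X Y : Type} [Fintype X] [Fintype Y] [DecidableEq X] [DecidableEq Y]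

/-- degree of `x` in `S`. -/
def rowc (S : Finset (X × Y)) (x : X) : ℕ := (Finset.univ.filter fun y => (x, y) ∈ S).card
/-- degree of `y` in `S`. -/
def colc (S : Finset (X × Y)) (y : Y) : ℕ := (Finset.univ.filter fun x => (x, y) ∈ S).card
/-- degree of `x` in `S`, ignoring the columns in `H`. -/
def lrow (H : Finset Y) (S : Finset (X × Y)) (x : X) : ℕ :=
  (Finset.univ.filter fun y => y ∉ H ∧ (x, y) ∈ S).card

/-- `S` contains a star with `m` leaves. -/
def StarP (m : ℕ) (S : Finset (X × Y)) : Prop := (∃ x, m ≤ rowc S x) ∨ ∃ y, m ≤ colc S y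

/-- Alice wins from the position with blue `B`, red `R`, Bob to move. -/
inductive BWin (m : ℕ) : Finset (X × Y) → Finset (X × Y) → Prop
  | won (B R) : StarP m B → BWin m B R
  | step (B R) (g : X × Y → X × Y) (hex : ∃ f, f ∉ B ∧ f ∉ R)
      (hs : ∀ f, f ∉ B → f ∉ R → ¬ StarP m (insert f R))
      (hg : ∀ f, f ∉ B → f ∉ R → g f ∉ B ∧ g f ∉ R ∧ g f ≠ f)
      (hw : ∀ f, f ∉ B → f ∉ R → BWin m (insert (g f) B) (insert f R)) : BWin m B R

theorem BWin.step' {m : ℕ} {B R : Finset (X × Y)} (hex : ∃ f, f ∉ B ∧ f ∉ R)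
    (h : ∀ f, f ∉ B → f ∉ R → ¬ StarP m (insert f R) ∧
      ∃ e, e ∉ B ∧ e ∉ R ∧ e ≠ f ∧ BWin m (insert e B) (insert f R)) : BWin m B R := by
  classical
  have h2 : ∀ f, ∃ e, f ∉ B → f ∉ R → e ∉ B ∧ e ∉ R ∧ e ≠ f ∧
      BWin m (insert e B) (insert f R) := by
    intro f
    by_cases h1 : f ∉ B ∧ f ∉ R
    · obtain ⟨e, he⟩ := (h f h1.1 h1.2).2
      exact ⟨e, fun _ _ => he⟩
    · exact ⟨f, fun a b => absurd ⟨a, b⟩ h1⟩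
  choose g hg using h2
  exact BWin.step B R g hex (fun f a b => (h f a b).1)
    (fun f a b => ⟨(hg f a b).1, (hg f a b).2.1, (hg f a b).2.2.1⟩)
    (fun f a b => (hg f a b).2.2.2)

theorem BWin.of_inv {m : ℕ} (I : Finset (X × Y) → Finset (X × Y) → Prop)
    (hI : ∀ B R, I B R → ¬ StarP m B → (∃ f, f ∉ B ∧ f ∉ R) ∧ ∀ f, f ∉ B → f ∉ R →
      ¬ StarP m (insert f R) ∧ ∃ e, e ∉ B ∧ e ∉ R ∧ e ≠ f ∧
        (I (insert e B) (insert f R) ∨ BWin m (insert e B) (insert f R))) :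
    ∀ B R, I B R → BWin m B R := by
  have key : ∀ (k : ℕ) (B R : Finset (X × Y)), Fintype.card (X × Y) ≤ k + B.card →
      I B R → BWin m B R := by
    intro k
    induction k with
    | zero =>
      intro B R hc hi
      by_cases hs : StarP m B
      · exact BWin.won _ _ hs
      · obtain ⟨⟨f, hf, _⟩, _⟩ := hI B R hi hs
        have : B = Finset.univ := by
          apply Finset.eq_univ_of_card
          have := Finset.card_le_univ B
          omega
        exact absurd (this ▸ Finset.mem_univ f) hf
    | succ k ih =>
      intro B R hc hi
      by_cases hs : StarP m B
      · exact BWin.won _ _ hs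
      · obtain ⟨hex, h⟩ := hI B R hi hs
        refine BWin.step' hex fun f h1 h2 => ?_
        obtain ⟨h3, e, he1, he2, he3, he4⟩ := h f h1 h2
        refine ⟨h3, e, he1, he2, he3, ?_⟩
        rcases he4 with he4 | he4
        · apply ih _ _ _ he4
          rw [Finset.card_insert_of_notMem he1]; omega
        · exact he4
  intro B R hi
  exact key (Fintype.card (X × Y)) B R (by omega) hi

theorem rowc_insert {S : Finset (X × Y)} {p : X × Y} (hp : p ∉ S) (x : X) :
    rowc (insert p S) x = rowc S x + if p.1 = x then 1 else 0 := by
  obtain ⟨a, b⟩ := p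
  unfold rowc
  split_ifs with h
  · simp only at h
    subst h
    rw [← Finset.card_insert_of_notMem (a := b) (by simpa using hp)]
    congr 1; ext y; simp
  · congr 1; ext y; simp at h ⊢; grind

theorem colc_insert {S : Finset (X × Y)} {p : X × Y} (hp : p ∉ S) (y : Y) :
    colc (insert p S) y = colc S y + if p.2 = y then 1 else 0 := by
  obtain ⟨a, b⟩ := p
  unfold colc
  split_ifs with h
  · simp only at h
    subst h
    rw [← Finset.card_insert_of_notMem (a := a) (by simpa using hp)]
    congr 1; ext y; simp
  · congr 1; ext y; simp at h ⊢; grind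

theorem lrow_insert (H : Finset Y) {S : Finset (X × Y)} {p : X × Y} (hp : p ∉ S) (x : X) :
    lrow H (insert p S) x = lrow H S x + if p.1 = x ∧ p.2 ∉ H then 1 else 0 := by
  obtain ⟨a, b⟩ := p
  unfold lrow
  split_ifs with h
  · simp only at h
    obtain ⟨rfl, h⟩ := h
    rw [← Finset.card_insert_of_notMem (a := b) (by simpa using fun _ => hp)]
    congr 1; ext y; simp; grind
  · congr 1; ext y; simp at h ⊢; grind

theorem rowc_le (H : Finset Y) (S : Finset (X × Y)) (x : X) : rowc S x ≤ lrow H S x + H.card := by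
  unfold rowc lrow
  rw [add_comm]
  refine le_trans (Finset.card_le_card ?_) (Finset.card_union_le _ _)
  intro y; simp; tauto

theorem col_free {B R : Finset (X × Y)} {y : Y}
    (h : colc B y + colc R y < Fintype.card X) : ∃ x, (x, y) ∉ B ∧ (x, y) ∉ R := by
  by_contra! hc
  have : Finset.univ ⊆ (Finset.univ.filter fun x => (x, y) ∈ B) ∪
      (Finset.univ.filter fun x => (x, y) ∈ R) := by
    intro x _; simp; have := hc x; tauto
  have h1 := (Finset.card_le_card this).trans (Finset.card_union_le _ _)
  rw [Finset.card_univ] at h1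
  unfold colc at h; omega

theorem col_le {B R : Finset (X × Y)} (hd : ∀ p, p ∈ B → p ∉ R) (y : Y) :
    colc B y + colc R y ≤ Fintype.card X := by
  unfold colc
  rw [← Finset.card_union_of_disjoint, ← Finset.card_univ]
  · exact Finset.card_le_card (Finset.subset_univ _)
  · rw [Finset.disjoint_left]; intro x; simp; exact hd _

theorem lrow_le (H : Finset Y) {B R : Finset (X × Y)} (hd : ∀ p, p ∈ B → p ∉ R) (x : X) :
    lrow H B x + lrow H R x + H.card ≤ Fintype.card Y := by
  unfold lrow
  rw [← Finset.card_union_of_disjoint, ← Finset.card_univ, ← Finset.card_union_of_disjoint]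
  · exact Finset.card_le_card (Finset.subset_univ _)
  · rw [Finset.disjoint_left]; intro x; simp; tauto
  · rw [Finset.disjoint_left]; intro y; simp; intro _ h _; exact hd _ h

/-- The line race. -/
theorem race {m : ℕ} (hX : Fintype.card X + 2 = 2 * m) (H : Finset Y) (c : ℕ)
    (hc : c + H.card + 1 ≤ m) (l : Finset (X × Y))
    (hl : ∀ S : Finset (X × Y), m ≤ (l ∩ S).card → StarP m S) (B R : Finset (X × Y))
    (hd : ∀ p, p ∈ B → p ∉ R) (hbal : ∀ y ∈ H, colc B y = colc R y)
    (hlH : ∀ p ∈ l, p.2 ∈ H → p ∈ B)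
    (hR : (R.filter fun p => p.2 ∉ H).card + m ≤ (l ∩ B).card + c)
    (hlR : 2 * m + (l ∩ R).card ≤ l.card + (l ∩ B).card) : BWin m B R := by
  refine BWin.of_inv (fun B R => (∀ p, p ∈ B → p ∉ R) ∧ (∀ y ∈ H, colc B y = colc R y) ∧
    (∀ p ∈ l, p.2 ∈ H → p ∈ B) ∧ (R.filter fun p => p.2 ∉ H).card + m ≤ (l ∩ B).card + c ∧
    2 * m + (l ∩ R).card ≤ l.card + (l ∩ B).card) ?_ B R ⟨hd, hbal, hlH, hR, hlR⟩
  clear hd hbal hlH hR hlR B R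
  rintro B R ⟨hd, hbal, hlH, hR, hlR⟩ hns
  have hb : (l ∩ B).card < m := by
    by_contra h; exact hns (hl B (by omega))
  have hfree : ∀ R' : Finset (X × Y), (l ∩ B).card + (l ∩ R').card < l.card →
      ∃ e ∈ l, e ∉ B ∧ e ∉ R' := by
    intro R' h
    by_contra! hc
    have : l ⊆ (l ∩ B) ∪ (l ∩ R') := by
      intro p hp; have := hc p hp; simp; tauto
    have h1 := (Finset.card_le_card this).trans (Finset.card_union_le _ _)
    omega
  refine ⟨?_, ?_⟩
  · obtain ⟨e, _, h1, h2⟩ := hfree R (by omega)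
    exact ⟨e, h1, h2⟩
  intro f hfB hfR
  have hd' : ∀ p, p ∈ B → p ∉ insert f R := by
    intro p hp h
    rcases Finset.mem_insert.1 h with rfl | h
    · exact hfB hp
    · exact hd p hp h
  have hRc : ((insert f R).filter fun p => p.2 ∉ H).card ≤
      (R.filter fun p => p.2 ∉ H).card + 1 := by
    have h := Finset.card_insert_le f (R.filter fun p => p.2 ∉ H)
    rw [Finset.filter_insert]; split_ifs <;> omega
  have hRc' : ((insert f R).filter fun p => p.2 ∉ H).card ≤ c := by omega
  refine ⟨?_, ?_⟩
  · rintro (⟨x, hx⟩ | ⟨y, hy⟩)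
    · have h1 := rowc_le H (insert f R) x
      have h2 : lrow H (insert f R) x ≤ ((insert f R).filter fun p => p.2 ∉ H).card := by
        unfold lrow
        apply Finset.card_le_card_of_injOn (fun y => (x, y))
        · intro y; simp; grind
        · intro a _ b _ h; simpa using h
      omega
    · by_cases hyH : y ∈ H
      · have h1 := col_le hd' y
        have h2 := colc_insert hfR y
        have h3 := hbal y hyH
        split_ifs at h2 <;> omega
      · have h2 : colc (insert f R) y ≤ ((insert f R).filter fun p => p.2 ∉ H).card := by
          unfold colc
          apply Finset.card_le_card_of_injOn (fun x => (x, y))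
          · intro y; simp; grind
          · intro a _ b _ h; simpa using h
        omega
  by_cases hfH : f.2 ∈ H
  · have h1 := col_le hd' f.2
    have h2 := colc_insert hfR f.2
    have h3 := hbal _ hfH
    rw [if_pos rfl] at h2
    obtain ⟨x, hx1, hx2⟩ := col_free (B := B) (R := insert f R) (y := f.2) (by omega)
    simp only [Finset.mem_insert, not_or] at hx2
    refine ⟨(x, f.2), hx1, hx2.2, hx2.1, Or.inl ⟨?_, ?_, ?_, ?_, ?_⟩⟩
    · intro p hp h
      rcases Finset.mem_insert.1 hp with rfl | hp
      · exact (by simpa using h : _ ∨ _).elim hx2.1 hx2.2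
      · exact hd' p hp h
    · intro y hy
      rw [colc_insert hx1, colc_insert hfR, hbal y hy]
    · intro p hp h; exact Finset.mem_insert_of_mem (hlH p hp h)
    · rw [Finset.filter_insert, if_neg (by simpa using hfH)]
      refine hR.trans ?_
      gcongr; exact Finset.subset_insert _ _
    · have : l ∩ insert f R = l ∩ R := by
        rw [Finset.inter_insert_of_notMem]; intro h; exact hfB (hlH f h hfH)
      rw [this]
      refine hlR.trans ?_
      gcongr; exact Finset.subset_insert _ _
  · have hlc : (l ∩ insert f R).card ≤ (l ∩ R).card + 1 := by
      by_cases hf : f ∈ l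
      · rw [Finset.inter_insert_of_mem hf]; exact Finset.card_insert_le _ _
      · rw [Finset.inter_insert_of_notMem hf]; omega
    obtain ⟨e, hel, heB, heR⟩ := hfree (insert f R) (by omega)
    have heH : e.2 ∉ H := fun h => heB (hlH e hel h)
    have hlB : (l ∩ insert e B).card = (l ∩ B).card + 1 := by
      rw [Finset.inter_insert_of_mem hel, Finset.card_insert_of_notMem (by simp [heB])]
    simp only [Finset.mem_insert, not_or] at heR
    refine ⟨e, heB, heR.2, heR.1, Or.inl ⟨?_, ?_, ?_, ?_, ?_⟩⟩
    · intro p hp h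
      rcases Finset.mem_insert.1 hp with rfl | hp
      · exact (by simpa using h : _ ∨ _).elim heR.1 heR.2
      · exact hd' p hp h
    · intro y hy
      rw [colc_insert heB, colc_insert hfR, hbal y hy, if_neg, if_neg]
      · rintro rfl; exact hfH hy
      · rintro rfl; exact heH hy
    · intro p hp h; exact Finset.mem_insert_of_mem (hlH p hp h)
    · omega
    · omega

/-- The invariant of the attack on column `ys`, Bob to move. -/
structure Att (m : ℕ) (H : Finset Y) (ys : Y) (T : Finset X) (B R : Finset (X × Y)) : Prop where
  hd : ∀ p, p ∈ B → p ∉ R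
  hbal : ∀ y ∈ H, colc B y = colc R y
  hT : T.card + 1 ≤ colc B ys
  hred : ∀ z ∉ H, (∀ x, (x, z) ∈ R → x ∈ T) ∨
    ∃ a b, b ∈ T ∧ (b, z) ∈ B ∧ ∀ x, (x, z) ∈ R → x = a ∨ x ∈ T
  hTy : ∀ x ∈ T, (x, ys) ∈ B ∨ (x, ys) ∈ R
  hTl : ∀ x ∈ T, lrow H R x ≤ lrow H B x + 1 ∨ ∀ y ∉ H, (x, y) ∈ B ∨ (x, y) ∈ R
  hnT : ∀ x ∉ T, lrow H R x ≤ lrow H B x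
  hlr : ∀ x, lrow H R x + H.card + 1 ≤ m
  hys : colc R ys + 2 ≤ colc B ys

theorem attack {m : ℕ} (hX : Fintype.card X + 2 = 2 * m) (H : Finset Y)
    (hH : H.card + Fintype.card Y + 3 ≤ 2 * m) (ys : Y) (hysH : ys ∉ H)
    (T : Finset X) (B R : Finset (X × Y)) (hA : Att m H ys T B R) : BWin m B R := by
  refine BWin.of_inv (fun B R => ∃ T, Att m H ys T B R) ?_ B R ⟨T, hA⟩
  clear hA T B R
  rintro B R ⟨T, hd, hbal, hT, hred, hTy, hTl, hnT, hlr, hys⟩ hns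
  have hcm : ∀ y, colc B y + 1 ≤ m := by
    intro y; by_contra h; exact hns (Or.inr ⟨y, by omega⟩)
  have hcys := hcm ys
  refine ⟨?_, ?_⟩
  · obtain ⟨x, h1, h2⟩ := col_free (B := B) (R := R) (y := ys) (by omega)
    exact ⟨_, h1, h2⟩
  rintro ⟨x0, z⟩ hfB hfR
  have hd' : ∀ p, p ∈ B → p ∉ insert (x0, z) R := by
    intro p hp h
    rcases Finset.mem_insert.1 h with rfl | h
    · exact hfB hp
    · exact hd p hp h
  have hrI := fun y => colc_insert hfR y
  have hlI := fun x => lrow_insert H hfR x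
  simp only at hrI hlI
  -- the new row bound
  have hlr' : ∀ x, lrow H (insert (x0, z) R) x + H.card + 1 ≤ m := by
    intro x
    have h1 := hlI x
    have h2 := hlr x
    by_cases hx : x0 = x ∧ z ∉ H
    · obtain ⟨rfl, hz⟩ := hx
      rw [if_pos ⟨rfl, hz⟩] at h1
      have h3 := lrow_le H hd' x0
      have h4 : lrow H R x0 ≤ lrow H B x0 + 1 := by
        by_cases hxT : x0 ∈ T
        · rcases hTl _ hxT with h | h
          · exact h
          · rcases h z hz with h | h
            · exact absurd h hfB
            · exact absurd h hfR
        · have := hnT _ hxT; omega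
      omega
    · rw [if_neg hx] at h1; omega
  -- helper for disjointness
  have hdd : ∀ e, e ∉ B → e ∉ insert (x0, z) R →
      ∀ p, p ∈ insert e B → p ∉ insert (x0, z) R := by
    intro e _ h2 p hp
    rcases Finset.mem_insert.1 hp with rfl | hp
    · exact h2
    · exact hd' p hp
  by_cases hz : z ∈ H
  · -- heavy column
    have hb := hbal z hz
    have h1 := col_le hd' z
    have h2 := hrI z
    rw [if_pos rfl] at h2
    have hredle : ∀ y ∉ H, colc R y ≤ T.card := by
      intro y hy
      unfold colc
      rcases hred y hy with h | ⟨a, b, hb1, hb2, h⟩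
      · apply Finset.card_le_card; intro x; simpa using h x
      · have : (Finset.univ.filter fun x => (x, y) ∈ R) ⊆ insert a (T.erase b) := by
          intro x hx
          simp only [Finset.mem_filter, Finset.mem_univ, true_and] at hx
          have hxb : x ≠ b := by rintro rfl; exact hd _ hb2 hx
          rcases h x hx with h | h
          · simp [h]
          · simp [h, hxb]
        have h1 := (Finset.card_le_card this).trans (Finset.card_insert_le _ _)
        rw [Finset.card_erase_of_mem hb1] at h1
        have := Finset.card_pos.2 ⟨b, hb1⟩
        omega
    refine ⟨?_, ?_⟩
    · rintro (⟨x, hx⟩ | ⟨y, hy⟩)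
      · have h1 := rowc_le H (insert (x0, z) R) x
        have := hlr' x; omega
      · by_cases hyH : y ∈ H
        · have h1 := col_le hd' y
          have h2 := hrI y
          have h3 := hbal y hyH
          split_ifs at h2 <;> omega
        · have h2 := hrI y
          rw [if_neg (by rintro rfl; exact hyH hz)] at h2
          have := hredle y hyH
          omega
    obtain ⟨x, hx1, hx2⟩ := col_free (B := B) (R := insert (x0, z) R) (y := z) (by omega)
    have hdn := hdd _ hx1 hx2
    simp only [Finset.mem_insert, not_or] at hx2
    refine ⟨(x, z), hx1, hx2.2, hx2.1, Or.inl ⟨T, ?_⟩⟩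
    have hzy : z ≠ ys := by rintro rfl; exact hysH hz
    have hlB := fun x' => lrow_insert H hx1 x'
    have hcB := fun y => colc_insert hx1 y
    simp only [hz, not_true_eq_false, and_false, if_false, add_zero] at hlB hlI hcB
    have hmem : ∀ x y, y ∉ H → ((x, y) ∈ insert (x0, z) R ↔ (x, y) ∈ R) := by
      intro x y hy; simp; rintro rfl rfl; exact absurd hz hy
    refine ⟨hdn, ?_, ?_, ?_, ?_, ?_, ?_, hlr', ?_⟩
    · intro y hy; rw [hcB, hrI, hbal y hy]
    · rw [hcB, if_neg hzy]; omega
    · intro w hw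
      rcases hred w hw with h | ⟨a, b, hb1, hb2, h⟩
      · left; intro x hx; exact h x ((hmem x w hw).1 hx)
      · right
        exact ⟨a, b, hb1, Finset.mem_insert_of_mem hb2, fun x hx => h x ((hmem x w hw).1 hx)⟩
    · intro x hx; have := hTy x hx; simp only [Finset.mem_insert]; tauto
    · intro x hx; rw [hlB, hlI]
      rcases hTl x hx with h | h
      · exact Or.inl h
      · right; intro y hy; have := h y hy; simp only [Finset.mem_insert]; tauto
    · intro x hx; rw [hlB, hlI]; exact hnT x hx
    · rw [hcB, hrI, if_neg hzy]; omega
  · -- light column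
    have hred' : ∀ w ∉ H, (∀ x, (x, w) ∈ insert (x0, z) R → x ∈ insert x0 T) ∨
        ∃ a b, b ∈ insert x0 T ∧ (b, w) ∈ B ∧
          ∀ x, (x, w) ∈ insert (x0, z) R → x = a ∨ x ∈ insert x0 T := by
      intro w hw
      rcases hred w hw with h | ⟨a, b, hb1, hb2, h⟩
      · left; intro x hx
        simp only [Finset.mem_insert, Prod.mk.injEq] at hx ⊢
        rcases hx with hx | hx
        · exact Or.inl hx.1
        · exact Or.inr (h x hx)
      · right
        refine ⟨a, b, Finset.mem_insert_of_mem hb1, hb2, ?_⟩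
        intro x hx
        simp only [Finset.mem_insert, Prod.mk.injEq] at hx ⊢
        rcases hx with hx | hx
        · exact Or.inr (Or.inl hx.1)
        · have := h x hx; tauto
    have hredle : ∀ y ∉ H, colc (insert (x0, z) R) y ≤ (insert x0 T).card := by
      intro y hy
      unfold colc
      rcases hred' y hy with h | ⟨a, b, hb1, hb2, h⟩
      · apply Finset.card_le_card; intro x hx; exact h x (by simpa using hx)
      · have : (Finset.univ.filter fun x => (x, y) ∈ insert (x0, z) R) ⊆
            insert a ((insert x0 T).erase b) := by
          intro x hx
          have hx := (Finset.mem_filter.1 hx).2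
          have hxb : x ≠ b := by rintro rfl; exact hd' _ hb2 hx
          rcases h x hx with h | h
          · simp [h]
          · exact Finset.mem_insert_of_mem (Finset.mem_erase.2 ⟨hxb, h⟩)
        have h1 := (Finset.card_le_card this).trans (Finset.card_insert_le _ _)
        rw [Finset.card_erase_of_mem hb1] at h1
        have := Finset.card_pos.2 ⟨b, hb1⟩
        omega
    have hTc := Finset.card_insert_le x0 T
    refine ⟨?_, ?_⟩
    · rintro (⟨x, hx⟩ | ⟨y, hy⟩)
      · have h1 := rowc_le H (insert (x0, z) R) x
        have := hlr' x; omega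
      · by_cases hyH : y ∈ H
        · have h1 := col_le hd' y
          have h2 := hrI y
          have h3 := hbal y hyH
          split_ifs at h2 <;> omega
        · have := hredle y hyH
          omega
    simp only [hz, not_false_eq_true, and_true] at hlI
    -- general closing argument
    have fin : ∀ e : X × Y, e.2 ∉ H → e ∉ B → e ∉ insert (x0, z) R →
        ((insert x0 T).card + 1 ≤ colc (insert e B) ys) →
        ((x0, ys) ∈ insert e B ∨ (x0, ys) ∈ insert (x0, z) R) →
        (lrow H R x0 ≤ lrow H (insert e B) x0 ∨ ∀ y ∉ H, (x0, y) ∈ insert e B ∨ (x0, y) ∈ insert (x0, z) R) →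
        (colc (insert (x0, z) R) ys + 2 ≤ colc (insert e B) ys) →
        ∃ e, e ∉ B ∧ e ∉ R ∧ e ≠ (x0, z) ∧ ((∃ T, Att m H ys T (insert e B) (insert (x0, z) R)) ∨
          BWin m (insert e B) (insert (x0, z) R)) := by
      intro e heH heB heR h1 h2 h3 h4
      have hdn := hdd e heB heR
      have heR2 := heR
      simp only [Finset.mem_insert, not_or] at heR2
      have hlB := fun x' => lrow_insert H heB x'
      have hlBle : ∀ x', lrow H B x' ≤ lrow H (insert e B) x' := by
        intro x'; rw [hlB]; omega
      refine ⟨e, heB, heR2.2, heR2.1, Or.inl ⟨insert x0 T, hdn, ?_, h1, ?_, ?_, ?_, ?_, hlr', h4⟩⟩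
      · intro y hy
        rw [colc_insert heB, hrI, hbal y hy, if_neg, if_neg]
        · rintro rfl; exact hz hy
        · rintro rfl; exact heH hy
      · intro w hw
        rcases hred' w hw with h | ⟨a, b, hb1, hb2, h⟩
        · exact Or.inl h
        · exact Or.inr ⟨a, b, hb1, Finset.mem_insert_of_mem hb2, h⟩
      · intro x hx
        rcases Finset.mem_insert.1 hx with rfl | hx
        · exact h2
        · rcases hTy x hx with h | h
          · exact Or.inl (Finset.mem_insert_of_mem h)
          · exact Or.inr (Finset.mem_insert_of_mem h)
      · intro x hx
        by_cases hxx : x = x0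
        · subst hxx
          rcases h3 with h3 | h3
          · left; rw [hlI, if_pos rfl]; omega
          · exact Or.inr h3
        · have hxT : x ∈ T := by simpa [hxx] using hx
          rcases hTl x hxT with h | h
          · left; rw [hlI, if_neg (Ne.symm hxx)]; have := hlBle x; omega
          · right; intro y hy
            rcases h y hy with h | h
            · exact Or.inl (Finset.mem_insert_of_mem h)
            · exact Or.inr (Finset.mem_insert_of_mem h)
      · intro x hx
        simp only [Finset.mem_insert, not_or] at hx
        have := hnT x hx.2
        have := hlBle x
        rw [hlI, if_neg (Ne.symm hx.1)]; omega
    have hrys := hrI ys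
    have hfr : ∃ x, (x, ys) ∉ B ∧ (x, ys) ∉ insert (x0, z) R := by
      apply col_free; split_ifs at hrys <;> omega
    by_cases hx0 : (x0, ys) ∉ B ∧ (x0, ys) ∉ insert (x0, z) R
    · have hcB := colc_insert hx0.1 ys
      rw [if_pos rfl] at hcB
      have hxT : x0 ∉ T := by
        intro h
        rcases hTy x0 h with h | h
        · exact hx0.1 h
        · exact hx0.2 (Finset.mem_insert_of_mem h)
      apply fin (x0, ys) hysH hx0.1 hx0.2
      · omega
      · simp
      · left; have := hnT x0 hxT; rw [lrow_insert H hx0.1]; omega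
      · split_ifs at hrys <;> omega
    have hx0' : (x0, ys) ∈ B ∨ (x0, ys) ∈ insert (x0, z) R := by tauto
    obtain ⟨x3, h31, h32⟩ := hfr
    have hcB := colc_insert h31 ys
    rw [if_pos rfl] at hcB
    by_cases hxT : x0 ∈ T
    · have hTe : insert x0 T = T := Finset.insert_eq_of_mem hxT
      have hzy : z ≠ ys := by
        rintro rfl
        rcases hTy x0 hxT with h | h
        · exact hfB h
        · exact hfR h
      rw [if_neg hzy] at hrys
      by_cases hw : ∃ w ∉ H, (x0, w) ∉ B ∧ (x0, w) ∉ insert (x0, z) R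
      · obtain ⟨w, hwH, hw1, hw2⟩ := hw
        have hcw := colc_insert hw1 ys
        apply fin (x0, w) hwH hw1 hw2
        · rw [hTe]; omega
        · rcases hx0' with h | h
          · exact Or.inl (Finset.mem_insert_of_mem h)
          · exact Or.inr h
        · left; rw [lrow_insert H hw1, if_pos ⟨rfl, hwH⟩]
          rcases hTl x0 hxT with h | h
          · exact h
          · rcases h z hz with h | h
            · exact absurd h hfB
            · exact absurd h hfR
        · omega
      · push Not at hw
        apply fin (x3, ys) hysH h31 h32
        · omega
        · rcases hx0' with h | h
          · exact Or.inl (Finset.mem_insert_of_mem h)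
          · exact Or.inr h
        · right; intro y hy
          by_cases h : (x0, y) ∈ B
          · exact Or.inl (Finset.mem_insert_of_mem h)
          · exact Or.inr (hw y hy h)
        · omega
    · apply fin (x3, ys) hysH h31 h32
      · omega
      · rcases hx0' with h | h
        · exact Or.inl (Finset.mem_insert_of_mem h)
        · exact Or.inr h
      · left; have := hnT x0 hxT; rw [lrow_insert H h31]; omega
      · split_ifs at hrys <;> omega

theorem lrow_le_one {H : Finset Y} {S : Finset (X × Y)} {x : X} (w : Y)
    (h : ∀ y ∉ H, (x, y) ∈ S → y = w) : lrow H S x ≤ 1 := by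
  unfold lrow
  rw [← Finset.card_singleton w]
  apply Finset.card_le_card
  intro y hy
  simp only [Finset.mem_filter, Finset.mem_univ, true_and] at hy
  simpa using h y hy.1 hy.2

theorem lrow_zero {H : Finset Y} {S : Finset (X × Y)} {x : X}
    (h : ∀ y ∉ H, (x, y) ∉ S) : lrow H S x = 0 := by
  unfold lrow
  rw [Finset.card_eq_zero, Finset.filter_eq_empty_iff]
  intro y _ hy; exact h y hy.1 hy.2

theorem lrow_pos {H : Finset Y} {S : Finset (X × Y)} {x : X} {y : Y}
    (hy : y ∉ H) (h : (x, y) ∈ S) : 1 ≤ lrow H S x := by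
  unfold lrow
  exact Finset.card_pos.2 ⟨y, by simp [hy, h]⟩

theorem colc_two {S : Finset (X × Y)} {a b : X} {y : Y} (hab : a ≠ b)
    (ha : (a, y) ∈ S) (hb : (b, y) ∈ S) : 2 ≤ colc S y := by
  unfold colc
  rw [← Finset.card_pair hab]
  apply Finset.card_le_card
  intro x hx; simp at hx; rcases hx with rfl | rfl <;> simp [*]

theorem colc_zero {S : Finset (X × Y)} {y : Y} (h : ∀ x, (x, y) ∉ S) : colc S y = 0 := by
  unfold colc
  rw [Finset.card_eq_zero, Finset.filter_eq_empty_iff]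
  intro x _; exact h x

/-- The row of `x`. -/
def rowl (x : X) : Finset (X × Y) := Finset.univ.image fun y => (x, y)
/-- The column of `y`. -/
def coll (y : Y) : Finset (X × Y) := Finset.univ.image fun x => (x, y)

theorem mem_rowl {x : X} {p : X × Y} : p ∈ rowl x ↔ p.1 = x := by
  obtain ⟨a, b⟩ := p; simp [rowl]; exact eq_comm
theorem mem_coll {y : Y} {p : X × Y} : p ∈ coll y ↔ p.2 = y := by
  obtain ⟨a, b⟩ := p; simp [coll]; exact eq_comm
theorem card_rowl (x : X) : (rowl x : Finset (X × Y)).card = Fintype.card Y := by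
  unfold rowl; rw [Finset.card_image_of_injective, Finset.card_univ]
  intro a b h; simpa using h
theorem card_coll (y : Y) : (coll y : Finset (X × Y)).card = Fintype.card X := by
  unfold coll; rw [Finset.card_image_of_injective, Finset.card_univ]
  intro a b h; simpa using h

theorem rowl_star {m : ℕ} (x : X) (S : Finset (X × Y)) (h : m ≤ (rowl x ∩ S).card) :
    StarP m S := by
  refine Or.inl ⟨x, h.trans ?_⟩
  unfold rowc
  apply Finset.card_le_card_of_injOn (fun p => p.2)
  · rintro ⟨a, b⟩ hp
    simp [mem_rowl] at hp ⊢
    obtain ⟨rfl, h5⟩ := hp; exact h5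
  · rintro ⟨a, b⟩ hp ⟨c, d⟩ hq h
    simp [mem_rowl] at hp hq h ⊢
    exact ⟨hp.1.trans hq.1.symm, h⟩

theorem coll_star {m : ℕ} (y : Y) (S : Finset (X × Y)) (h : m ≤ (coll y ∩ S).card) :
    StarP m S := by
  refine Or.inr ⟨y, h.trans ?_⟩
  unfold colc
  apply Finset.card_le_card_of_injOn (fun p => p.1)
  · rintro ⟨a, b⟩ hp
    simp [mem_coll] at hp ⊢
    obtain ⟨rfl, h5⟩ := hp; exact h5
  · rintro ⟨a, b⟩ hp ⟨c, d⟩ hq h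
    simp [mem_coll] at hp hq h ⊢
    exact ⟨h, hp.1.trans hq.1.symm⟩

/-- Reply in a balanced column. -/
theorem bal_reply {m : ℕ} (hX : Fintype.card X + 2 = 2 * m) {H : Finset Y}
    {B R : Finset (X × Y)} (hd : ∀ p, p ∈ B → p ∉ R) (hbal : ∀ y ∈ H, colc B y = colc R y)
    {f : X × Y} (hfB : f ∉ B) (hfR : f ∉ R) (hf : f.2 ∈ H) :
    ∃ e, e ∉ B ∧ e ∉ R ∧ e ≠ f ∧ e.2 = f.2 ∧
      (∀ p, p ∈ insert e B → p ∉ insert f R) ∧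
      (∀ y ∈ H, colc (insert e B) y = colc (insert f R) y) := by
  have hd' : ∀ p, p ∈ B → p ∉ insert f R := by
    intro p hp h
    rcases Finset.mem_insert.1 h with rfl | h
    · exact hfB hp
    · exact hd p hp h
  have h1 := col_le hd' f.2
  have h2 := colc_insert hfR f.2
  have h3 := hbal _ hf
  rw [if_pos rfl] at h2
  obtain ⟨x, hx1, hx2⟩ := col_free (B := B) (R := insert f R) (y := f.2) (by omega)
  have hx3 := hx2
  simp only [Finset.mem_insert, not_or] at hx2
  refine ⟨(x, f.2), hx1, hx2.2, hx2.1, rfl, ?_, ?_⟩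
  · intro p hp
    rcases Finset.mem_insert.1 hp with rfl | hp
    · exact hx3
    · exact hd' p hp
  · intro y hy
    rw [colc_insert hx1, colc_insert hfR, hbal y hy]

/-- No red star when few light reds. -/
theorem no_star {m : ℕ} (hX : Fintype.card X + 2 = 2 * m) {H : Finset Y}
    {B R : Finset (X × Y)} (hd : ∀ p, p ∈ B → p ∉ R) (hbal : ∀ y ∈ H, colc B y = colc R y)
    {f : X × Y} (hfB : f ∉ B) (hfR : f ∉ R)
    (hc : ((insert f R).filter fun p => p.2 ∉ H).card + H.card + 1 ≤ m) :
    ¬ StarP m (insert f R) := by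
  have hd' : ∀ p, p ∈ B → p ∉ insert f R := by
    intro p hp h
    rcases Finset.mem_insert.1 h with rfl | h
    · exact hfB hp
    · exact hd p hp h
  rintro (⟨x, hx⟩ | ⟨y, hy⟩)
  · have h1 := rowc_le H (insert f R) x
    have h2 : lrow H (insert f R) x ≤ ((insert f R).filter fun p => p.2 ∉ H).card := by
      unfold lrow
      apply Finset.card_le_card_of_injOn (fun y => (x, y))
      · intro y; simp; grind
      · intro a _ b _ h; simpa using h
    omega
  · by_cases hyH : y ∈ H
    · have h1 := col_le hd' y
      have h2 := colc_insert hfR y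
      have h3 := hbal y hyH
      split_ifs at h2 <;> omega
    · have h2 : colc (insert f R) y ≤ ((insert f R).filter fun p => p.2 ∉ H).card := by
        unfold colc
        apply Finset.card_le_card_of_injOn (fun x => (x, y))
        · intro y; simp; grind
        · intro a _ b _ h; simpa using h
      omega

/-- Second stage invariant. -/
structure P2 (m : ℕ) (x x1 : X) (H : Finset Y) (y1 y2 : Y) (B R : Finset (X × Y)) : Prop where
  hd : ∀ p, p ∈ B → p ∉ R
  hbal : ∀ y ∈ H, colc B y = colc R y
  hxH : ∀ y ∈ H, (x, y) ∈ B
  hx1 : (x, y1) ∈ B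
  hx2 : (x, y2) ∈ B
  hB : ∀ p ∈ B, p.2 ∉ H → p = (x, y1) ∨ p = (x, y2)
  hR : ∀ p ∈ R, p.2 ∉ H → p = (x1, y1)
  hR1 : (x1, y1) ∈ R

theorem stage2 {m : ℕ} (hX : Fintype.card X + 2 = 2 * m) (hY : m ≤ Fintype.card Y)
    (H : Finset Y)
    (hH : H.card + Fintype.card Y + 3 = 2 * m) (x x1 : X) (hxx : x1 ≠ x) (y1 y2 : Y)
    (hy1 : y1 ∉ H) (hy2 : y2 ∉ H) (hyy : y1 ≠ y2) (B R : Finset (X × Y))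
    (hP : P2 m x x1 H y1 y2 B R) : BWin m B R := by
  refine BWin.of_inv (fun B R => P2 m x x1 H y1 y2 B R) ?_ B R hP
  clear hP B R
  rintro B R ⟨hd, hbal, hxH, hx1, hx2, hB, hR, hR1⟩ hns
  refine ⟨⟨(x1, y2), ?_, ?_⟩, ?_⟩
  · intro h
    rcases hB _ h hy2 with h | h <;> simp only [Prod.mk.injEq] at h
    · exact hxx h.1
    · exact hxx h.1
  · intro h
    have := hR _ h hy2
    simp only [Prod.mk.injEq] at this
    exact hyy this.2.symm
  intro f hfB hfR
  have hd' : ∀ p, p ∈ B → p ∉ insert f R := by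
    intro p hp h
    rcases Finset.mem_insert.1 h with rfl | h
    · exact hfB hp
    · exact hd p hp h
  have hlc : ((insert f R).filter fun p => p.2 ∉ H).card ≤ 2 := by
    refine le_trans (Finset.card_le_card (t := {f, (x1, y1)}) ?_) Finset.card_le_two
    intro p hp
    simp only [Finset.mem_filter, Finset.mem_insert, Finset.mem_singleton] at hp ⊢
    rcases hp.1 with h | h
    · exact Or.inl h
    · exact Or.inr (hR p h hp.2)
  refine ⟨no_star hX hd hbal hfB hfR (by omega), ?_⟩
  by_cases hfH : f.2 ∈ H
  · obtain ⟨e, he1, he2, he3, he4, he5, he6⟩ := bal_reply hX hd hbal hfB hfR hfH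
    refine ⟨e, he1, he2, he3, Or.inl ⟨he5, he6, ?_, ?_, ?_, ?_, ?_, ?_⟩⟩
    · intro y hy; exact Finset.mem_insert_of_mem (hxH y hy)
    · exact Finset.mem_insert_of_mem hx1
    · exact Finset.mem_insert_of_mem hx2
    · intro p hp hpH
      rcases Finset.mem_insert.1 hp with rfl | hp
      · exact absurd (he4 ▸ hfH) hpH
      · exact hB p hp hpH
    · intro p hp hpH
      rcases Finset.mem_insert.1 hp with rfl | hp
      · exact absurd hfH hpH
      · exact hR p hp hpH
    · exact Finset.mem_insert_of_mem hR1
  obtain ⟨x0, z⟩ := f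
  simp only at hfH
  by_cases hx0 : x0 = x
  · subst hx0
    have hz1 : z ≠ y1 := by rintro rfl; exact hfB hx1
    have hz2 : z ≠ y2 := by rintro rfl; exact hfB hx2
    have he1 : (x1, y2) ∉ B := by
      intro h
      rcases hB _ h hy2 with h | h <;> simp only [Prod.mk.injEq] at h
      · exact hxx h.1
      · exact hxx h.1
    have he2 : (x1, y2) ∉ R := by
      intro h
      have := hR _ h hy2
      simp only [Prod.mk.injEq] at this
      exact hyy this.2.symm
    have he3 : (x1, y2) ≠ (x0, z) := by simp [hxx]
    refine ⟨(x1, y2), he1, he2, he3, Or.inr ?_⟩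
    have hR' : ∀ a b, (a, b) ∈ insert (x0, z) R → b ∉ H → (a = x0 ∧ b = z) ∨ (a = x1 ∧ b = y1) := by
      intro a b hp hb
      rcases Finset.mem_insert.1 hp with h | h
      · left; simpa using h
      · right; simpa using hR _ h hb
    have hle : ∀ a, lrow H (insert (x0, z) R) a ≤ 1 := by
      intro a
      by_cases ha : a = x0
      · apply lrow_le_one z
        intro y hy h
        rcases hR' _ _ h hy with h | h
        · exact h.2
        · exact absurd (h.1.symm.trans ha) hxx
      · apply lrow_le_one y1
        intro y hy h
        rcases hR' _ _ h hy with h | h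
        · exact absurd h.1 ha
        · exact h.2
    have hc2 : 2 ≤ colc (insert (x1, y2) B) y2 := by
      apply colc_two hxx
      · simp
      · exact Finset.mem_insert_of_mem hx2
    apply attack hX H (by omega) y2 hy2 {x0}
    refine ⟨?_, ?_, ?_, ?_, ?_, ?_, ?_, ?_, ?_⟩
    · intro p hp
      rcases Finset.mem_insert.1 hp with rfl | hp
      · simp [he2, hxx]
      · exact hd' p hp
    · intro y hy
      rw [colc_insert he1, colc_insert hfR, hbal y hy, if_neg, if_neg]
      · rintro rfl; exact hfH hy
      · rintro rfl; exact hy2 hy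
    · simpa using hc2
    · intro w hw
      by_cases hw1 : w = y1
      · subst hw1
        right
        refine ⟨x1, x0, by simp, Finset.mem_insert_of_mem hx1, ?_⟩
        intro a ha
        rcases hR' _ _ ha hw with h | h
        · right; simp [h.1]
        · exact Or.inl h.1
      · left
        intro a ha
        rcases hR' _ _ ha hw with h | h
        · simp [h.1]
        · exact absurd h.2 hw1
    · intro a ha
      simp only [Finset.mem_singleton] at ha
      subst ha
      exact Or.inl (Finset.mem_insert_of_mem hx2)
    · intro a _
      left; have := hle a; omega
    · intro a ha
      simp only [Finset.mem_singleton] at ha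
      by_cases ha1 : a = x1
      · subst ha1
        have h1 := hle a
        have h2 : 1 ≤ lrow H (insert (a, y2) B) a := lrow_pos hy2 (by simp)
        omega
      · rw [lrow_zero]
        · omega
        · intro y hy h
          rcases hR' _ _ h hy with h | h
          · exact ha h.1
          · exact ha1 h.1
    · intro a; have := hle a; omega
    · rw [colc_zero]
      · omega
      · intro a h
        rcases hR' _ _ h hy2 with h | h
        · exact hz2 h.2.symm
        · exact hyy h.2.symm
  · -- row race
    have : ∃ w, w ∉ insert y1 (insert y2 H) := by
      by_contra! hc
      have h1 : Finset.univ ⊆ insert y1 (insert y2 H) := fun w _ => hc w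
      have h2 := Finset.card_le_card h1
      have h3 := Finset.card_insert_le y1 (insert y2 H)
      have h4 := Finset.card_insert_le y2 H
      rw [Finset.card_univ] at h2
      omega
    obtain ⟨w, hw⟩ := this
    simp only [Finset.mem_insert, not_or] at hw
    have hrow : ∀ y, (x, y) ∉ insert (x0, z) R := by
      intro y h
      by_cases hy : y ∈ H
      · exact hd' _ (hxH y hy) h
      · rcases Finset.mem_insert.1 h with h | h
        · simp only [Prod.mk.injEq] at h; exact hx0 h.1.symm
        · have := hR _ h hy
          simp only [Prod.mk.injEq] at this; exact hxx this.1.symm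
    have he1 : (x, w) ∉ B := by
      intro h
      rcases hB _ h hw.2.2 with h | h <;> simp only [Prod.mk.injEq] at h
      · exact hw.1 h.2
      · exact hw.2.1 h.2
    have he2 := hrow w
    simp only [Finset.mem_insert, not_or] at he2
    refine ⟨(x, w), he1, he2.2, he2.1, Or.inr ?_⟩
    have hb : H.card + 3 ≤ (rowl x ∩ insert (x, w) B).card := by
      have h1 : (insert w (insert y1 (insert y2 H))).card = H.card + 3 := by
        rw [Finset.card_insert_of_notMem (by simp [hw]), Finset.card_insert_of_notMem (by simp [hyy, hy1]),
          Finset.card_insert_of_notMem hy2]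
      rw [← h1]
      apply Finset.card_le_card_of_injOn (fun y => (x, y))
      · intro y hy
        simp only [Finset.coe_insert, Set.mem_insert_iff, Finset.mem_coe] at hy
        simp only [Finset.coe_inter, Set.mem_inter_iff, Finset.mem_coe, mem_rowl, true_and]
        rcases hy with rfl | rfl | rfl | hy
        · simp
        · exact Finset.mem_insert_of_mem hx1
        · exact Finset.mem_insert_of_mem hx2
        · exact Finset.mem_insert_of_mem (hxH y hy)
      · intro a _ b _ h; simpa using h
    have hr0 : (rowl x ∩ insert (x0, z) R).card = 0 := by
      rw [Finset.card_eq_zero, Finset.eq_empty_iff_forall_notMem]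
      rintro ⟨a, b⟩ hp
      obtain ⟨h1, h2⟩ := Finset.mem_inter.1 hp
      rw [mem_rowl] at h1
      simp only at h1
      subst h1
      exact hrow b h2
    apply race hX H (m - 1 - H.card) (by omega) (rowl x) (rowl_star x)
    · intro p hp
      rcases Finset.mem_insert.1 hp with rfl | hp
      · exact hrow w
      · exact hd' p hp
    · intro y hy
      rw [colc_insert he1, colc_insert hfR, hbal y hy, if_neg, if_neg]
      · rintro rfl; exact hfH hy
      · rintro rfl; exact hw.2.2 hy
    · rintro ⟨a, b⟩ hp hpH
      rw [mem_rowl] at hp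
      simp only at hp hpH
      subst hp
      exact Finset.mem_insert_of_mem (hxH b hpH)
    · omega
    · rw [hr0, card_rowl]; omega

/-- First stage invariant. -/
structure P1 (m : ℕ) (x : X) (H : Finset Y) (y : Y) (B R : Finset (X × Y)) : Prop where
  hd : ∀ p, p ∈ B → p ∉ R
  hbal : ∀ y ∈ H, colc B y = colc R y
  hxH : ∀ y ∈ H, (x, y) ∈ B
  hy : y ∉ H
  hxy : (x, y) ∈ B
  hB : ∀ p ∈ B, p.2 ∉ H → p = (x, y)
  hR : ∀ p ∈ R, p.2 ∈ H
  hH : H.card + Fintype.card Y + 3 ≤ 2 * m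

theorem stage1 {m : ℕ} (hX : Fintype.card X + 2 = 2 * m) (hY : m ≤ Fintype.card Y)
    (x : X) (H : Finset Y) (y : Y) (B R : Finset (X × Y))
    (hP : P1 m x H y B R) : BWin m B R := by
  refine BWin.of_inv (fun B R => ∃ H y, P1 m x H y B R) ?_ B R ⟨H, y, hP⟩
  clear hP B R H y
  rintro B R ⟨H, y, hd, hbal, hxH, hy, hxy, hB, hR, hH⟩ hns
  have hx3 : ∃ x3, x3 ≠ x := by
    by_contra! hc
    have : Fintype.card X ≤ 1 := Fintype.card_le_one_iff.2 fun a b => (hc a).trans (hc b).symm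
    omega
  obtain ⟨x3, hx3⟩ := hx3
  have hcol : ∀ a, a ≠ x → (a, y) ∉ B ∧ (a, y) ∉ R := by
    intro a ha
    refine ⟨fun h => ?_, fun h => hy (hR _ h)⟩
    have := hB _ h hy
    simp only [Prod.mk.injEq] at this
    exact ha this.1
  refine ⟨⟨(x3, y), hcol x3 hx3⟩, ?_⟩
  intro f hfB hfR
  have hd' : ∀ p, p ∈ B → p ∉ insert f R := by
    intro p hp h
    rcases Finset.mem_insert.1 h with rfl | h
    · exact hfB hp
    · exact hd p hp h
  have hlc : ((insert f R).filter fun p => p.2 ∉ H).card ≤ 1 := by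
    refine le_trans (Finset.card_le_card (t := {f}) ?_) (by simp)
    intro p hp
    simp only [Finset.mem_filter, Finset.mem_insert, Finset.mem_singleton] at hp ⊢
    rcases hp.1 with h | h
    · exact h
    · exact absurd (hR p h) hp.2
  refine ⟨no_star hX hd hbal hfB hfR (by omega), ?_⟩
  by_cases hfH : f.2 ∈ H
  · obtain ⟨e, he1, he2, he3, he4, he5, he6⟩ := bal_reply hX hd hbal hfB hfR hfH
    refine ⟨e, he1, he2, he3, Or.inl ⟨H, y, he5, he6, ?_, hy, ?_, ?_, ?_, hH⟩⟩
    · intro y hy; exact Finset.mem_insert_of_mem (hxH y hy)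
    · exact Finset.mem_insert_of_mem hxy
    · intro p hp hpH
      rcases Finset.mem_insert.1 hp with rfl | hp
      · exact absurd (he4 ▸ hfH) hpH
      · exact hB p hp hpH
    · intro p hp
      rcases Finset.mem_insert.1 hp with rfl | hp
      · exact hfH
      · exact hR p hp
  obtain ⟨x0, z⟩ := f
  simp only at hfH
  by_cases hzy : z = y
  · subst hzy
    have hxx : x0 ≠ x := by rintro rfl; exact hfB hxy
    have : ∃ w, w ∉ insert z H := by
      by_contra! hc
      have h1 : Finset.univ ⊆ insert z H := fun w _ => hc w
      have h2 := Finset.card_le_card h1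
      have h4 := Finset.card_insert_le z H
      rw [Finset.card_univ] at h2
      omega
    obtain ⟨w, hw⟩ := this
    have hw' := hw
    simp only [Finset.mem_insert, not_or] at hw
    have he1 : (x, w) ∉ B := by
      intro h
      have := hB _ h hw.2
      simp only [Prod.mk.injEq] at this
      exact hw.1 this.2
    have he2 : (x, w) ∉ R := fun h => hw.2 (hR _ h)
    have he3 : (x, w) ≠ (x0, z) := by simp [hw.1]
    have hdn : ∀ p, p ∈ insert (x, w) B → p ∉ insert (x0, z) R := by
      intro p hp
      rcases Finset.mem_insert.1 hp with rfl | hp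
      · simp only [Finset.mem_insert, not_or]; exact ⟨he3, he2⟩
      · exact hd' p hp
    refine ⟨(x, w), he1, he2, he3, ?_⟩
    by_cases hc : H.card + 1 + Fintype.card Y + 3 ≤ 2 * m
    · left
      refine ⟨insert z H, w, hdn, ?_, ?_, hw', by simp, ?_, ?_, ?_⟩
      · intro y hy
        rw [colc_insert he1, colc_insert hfR]
        have hwy : w ≠ y := by rintro rfl; exact hw' hy
        by_cases hyz : z = y
        · subst hyz
          rw [if_neg hwy, if_pos rfl]
          have h1 : colc R z = 0 := colc_zero fun a h => hfH (hR _ h)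
          have h2 : colc B z = 1 := by
            unfold colc
            rw [Finset.card_eq_one]
            refine ⟨x, ?_⟩
            ext a
            simp only [Finset.mem_filter, Finset.mem_univ, true_and, Finset.mem_singleton]
            constructor
            · intro h; have := hB _ h hfH
              simp only [Prod.mk.injEq] at this; exact this.1
            · rintro rfl; exact hxy
          omega
        · rw [if_neg hwy, if_neg hyz, hbal y]
          rcases Finset.mem_insert.1 hy with h | h
          · exact absurd h.symm hyz
          · exact h
      · intro y hy
        rcases Finset.mem_insert.1 hy with rfl | hy
        · exact Finset.mem_insert_of_mem hxy
        · exact Finset.mem_insert_of_mem (hxH y hy)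
      · intro p hp hpH
        simp only [Finset.mem_insert, not_or] at hpH
        rcases Finset.mem_insert.1 hp with rfl | hp
        · rfl
        · have := hB p hp hpH.2
          subst this
          exact absurd rfl hpH.1
      · intro p hp
        rcases Finset.mem_insert.1 hp with rfl | hp
        · simp
        · exact Finset.mem_insert_of_mem (hR p hp)
      · rw [Finset.card_insert_of_notMem hfH]; exact hc
    · right
      apply stage2 hX hY H (by omega) x x0 hxx z w hfH hw.2 (Ne.symm hw.1)
      refine ⟨hdn, ?_, ?_, Finset.mem_insert_of_mem hxy, by simp, ?_, ?_, by simp⟩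
      · intro y hy
        rw [colc_insert he1, colc_insert hfR, hbal y hy, if_neg, if_neg]
        · rintro rfl; exact hfH hy
        · rintro rfl; exact hw.2 hy
      · intro y hy; exact Finset.mem_insert_of_mem (hxH y hy)
      · intro p hp hpH
        rcases Finset.mem_insert.1 hp with rfl | hp
        · exact Or.inr rfl
        · exact Or.inl (hB p hp hpH)
      · intro p hp hpH
        rcases Finset.mem_insert.1 hp with rfl | hp
        · rfl
        · exact absurd (hR p hp) hpH
  · -- attack on column y
    obtain ⟨a, ha, hax⟩ : ∃ a, a ≠ x ∧ (x0 = x ∨ x0 = a) := by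
      by_cases h : x0 = x
      · exact ⟨x3, hx3, Or.inl h⟩
      · exact ⟨x0, h, Or.inr rfl⟩
    obtain ⟨he1, he2⟩ := hcol a ha
    have he3 : (a, y) ≠ (x0, z) := by
      intro h; simp only [Prod.mk.injEq] at h; exact hzy h.2.symm
    refine ⟨(a, y), he1, he2, he3, Or.inr ?_⟩
    have hR' : ∀ a b, (a, b) ∈ insert (x0, z) R → b ∉ H → (a = x0 ∧ b = z) := by
      intro a b hp hb
      rcases Finset.mem_insert.1 hp with h | h
      · simpa using h
      · exact absurd (hR _ h) hb
    have hle : ∀ a, lrow H (insert (x0, z) R) a ≤ 1 := fun a =>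
      lrow_le_one z fun y hy h => (hR' _ _ h hy).2
    have hc2 : 2 ≤ colc (insert (a, y) B) y := by
      apply colc_two ha
      · simp
      · exact Finset.mem_insert_of_mem hxy
    apply attack hX H hH y hy {x0}
    refine ⟨?_, ?_, ?_, ?_, ?_, ?_, ?_, ?_, ?_⟩
    · intro p hp
      rcases Finset.mem_insert.1 hp with rfl | hp
      · simp only [Finset.mem_insert, not_or]; exact ⟨he3, he2⟩
      · exact hd' p hp
    · intro y' hy'
      rw [colc_insert he1, colc_insert hfR, hbal y' hy', if_neg, if_neg]
      · rintro rfl; exact hfH hy'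
      · rintro rfl; exact hy hy'
    · simpa using hc2
    · intro w hw
      left
      intro b hb
      simp [(hR' _ _ hb hw).1]
    · intro b hb
      simp only [Finset.mem_singleton] at hb
      subst hb
      left
      rcases hax with rfl | rfl
      · exact Finset.mem_insert_of_mem hxy
      · simp
    · intro b _
      left; have := hle b; omega
    · intro b hb
      simp only [Finset.mem_singleton] at hb
      rw [lrow_zero]
      · omega
      · intro y hy h
        exact hb (hR' _ _ h hy).1
    · intro b; have := hle b; omega
    · rw [colc_zero]
      · omega
      · intro a h
        exact hzy (hR' _ _ h hy).2.symm

theorem start {m : ℕ} (hm : 2 ≤ m) (hX : Fintype.card X + 2 = 2 * m) (hY : m ≤ Fintype.card Y)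
    (hY2 : Fintype.card Y + 2 ≤ 2 * m) (x : X) (y : Y) : BWin m {(x, y)} (∅ : Finset (X × Y)) := by
  have hx3 : ∃ x3, x3 ≠ x := by
    by_contra! hc
    have : Fintype.card X ≤ 1 := Fintype.card_le_one_iff.2 fun a b => (hc a).trans (hc b).symm
    omega
  obtain ⟨x3, hx3⟩ := hx3
  by_cases hc : Fintype.card Y + 3 ≤ 2 * m
  · apply stage1 hX hY x ∅ y
    exact ⟨by simp, by simp, by simp, by simp, by simp, by simp, by simp, by simpa using hc⟩
  · apply BWin.step'
    · exact ⟨(x3, y), by simp [hx3], by simp⟩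
    intro f hfB hfR
    refine ⟨no_star hX (H := ∅) (B := {(x, y)}) (by simp) (by simp) hfB hfR ?_, ?_⟩
    · simp; omega
    · have main : ∀ l : Finset (X × Y), (∀ S : Finset (X × Y), m ≤ (l ∩ S).card → StarP m S) →
          (x, y) ∈ l → l.card + 2 = 2 * m → f ∉ l →
          ∃ e ∉ ({(x, y)} : Finset (X × Y)), e ∉ (∅ : Finset (X × Y)) ∧ e ≠ f ∧
            BWin m (insert e {(x, y)}) (insert f ∅) := by
        intro l hl hxl hcl hfl
        obtain ⟨e, he, hex⟩ := Finset.exists_mem_ne (by omega : 1 < l.card) (x, y)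
        have hef : e ≠ f := by rintro rfl; exact hfl he
        refine ⟨e, by simpa using hex, by simp, hef, ?_⟩
        have hb : (l ∩ insert e {(x, y)}).card = 2 := by
          rw [Finset.inter_eq_right.2, Finset.card_pair hex]
          intro p hp
          simp only [Finset.mem_insert, Finset.mem_singleton] at hp
          rcases hp with rfl | rfl <;> assumption
        have hr : (l ∩ insert f ∅).card = 0 := by
          rw [Finset.card_eq_zero, Finset.inter_insert_of_notMem hfl, Finset.inter_empty]
        apply race hX ∅ (m - 1) (by simp; omega) l hl
        · intro p hp h
          simp only [Finset.mem_insert, Finset.mem_singleton, Finset.notMem_empty, or_false] at hp h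
          subst h
          rcases hp with h | h
          · exact hef h.symm
          · simp [h] at hfB
        · simp
        · simp
        · rw [hb]; simp; omega
        · omega
      by_cases hf : f.1 = x
      · have hf2 : f.2 ≠ y := by
          intro h; exact hfB (by simp [Prod.ext_iff, hf, h])
        exact main (coll y) (coll_star y) (by simp [mem_coll]) (by rw [card_coll]; omega)
          (by simpa [mem_coll] using hf2)
      · exact main (rowl x) (rowl_star x) (by simp [mem_rowl]) (by rw [card_rowl]; omega)
          (by simpa [mem_rowl] using hf)

end Game

section Bridge
open AchievementGame
variable {X Y : Type} [Fintype X] [Fintype Y] [DecidableEq X] [DecidableEq Y]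

/-- The edge of the complete bipartite graph given by a pair. -/
def emb (p : X × Y) : Sym2 (X ⊕ Y) := s(Sum.inl p.1, Sum.inr p.2)

theorem emb_inj : Function.Injective (emb : X × Y → Sym2 (X ⊕ Y)) := by
  rintro ⟨a, b⟩ ⟨c, d⟩ h
  simpa [emb] using h

theorem mem_edge (e : Sym2 (X ⊕ Y)) :
    e ∈ (completeBipartiteGraph X Y).edgeSet ↔ ∃ p, e = emb p := by
  induction e with
  | _ a b =>
    rcases a with a | a <;> rcases b with b | b <;> simp [emb, completeBipartiteGraph]

theorem edge_eq : (completeBipartiteGraph X Y).edgeSet = Set.range emb := by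
  ext e; rw [mem_edge]; simp [eq_comm]

theorem edge_card : (completeBipartiteGraph X Y).edgeSet.ncard = Fintype.card (X × Y) := by
  rw [edge_eq, ← Set.image_univ, Set.ncard_image_of_injective _ emb_inj, Set.ncard_univ,
    Nat.card_eq_fintype_card]

theorem hist_len {α : Type*} (σ τ : Strategy α) (n : ℕ) : (hist σ τ n).length = n := by
  induction n with
  | zero => rfl
  | succ n ih => simp [hist, ih]

theorem hist_succ {α : Type*} (σ τ : Strategy α) (n : ℕ) :
    hist σ τ (n + 1) = hist σ τ n ++ [move σ τ n] := rfl

theorem mem_hist {α : Type*} (σ τ : Strategy α) (n : ℕ) (e : Sym2 α) :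
    e ∈ hist σ τ n ↔ ∃ i < n, move σ τ i = e := by
  induction n with
  | zero => simp [hist]
  | succ n ih =>
    rw [hist_succ, List.mem_append, ih, List.mem_singleton]
    constructor
    · rintro (⟨i, hi, h⟩ | h)
      · exact ⟨i, by omega, h⟩
      · exact ⟨n, by omega, h.symm⟩
    · rintro ⟨i, hi, h⟩
      rcases Nat.lt_succ_iff_lt_or_eq.1 hi with h1 | rfl
      · exact Or.inl ⟨i, h1, h⟩
      · exact Or.inr h.symm

theorem hist_get {α : Type*} (σ τ : Strategy α) (n i : ℕ) (hi : i < n) :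
    (hist σ τ n)[i]? = some (move σ τ i) := by
  induction n with
  | zero => omega
  | succ n ih =>
    rw [hist_succ]
    rcases Nat.lt_succ_iff_lt_or_eq.1 hi with h1 | rfl
    · rw [List.getElem?_append_left (by rw [hist_len]; exact h1)]; exact ih h1
    · rw [List.getElem?_append_right (by rw [hist_len])]; simp [hist_len]

theorem exists_free {l : List (Sym2 (X ⊕ Y))} (h : l.length < Fintype.card (X × Y)) :
    ∃ e ∈ (completeBipartiteGraph X Y).edgeSet, e ∉ l := by
  classical
  by_contra! hc
  have h1 : (Finset.univ.image (emb : X × Y → _)) ⊆ l.toFinset := by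
    intro e he
    simp only [Finset.mem_image, Finset.mem_univ, true_and] at he
    obtain ⟨p, rfl⟩ := he
    rw [List.mem_toFinset]
    exact hc _ ((mem_edge _).2 ⟨p, rfl⟩)
  have h2 := (Finset.card_le_card h1).trans (List.toFinset_card_le l)
  rw [Finset.card_image_of_injective _ emb_inj, Finset.card_univ] at h2
  omega

theorem move_legal {σ τ : Strategy (X ⊕ Y)} (hσ : Strategy.Valid (completeBipartiteGraph X Y) σ)
    (hτ : Strategy.Valid (completeBipartiteGraph X Y) τ) {n : ℕ} (hn : n < Fintype.card (X × Y)) :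
    (∃ p, move σ τ n = emb p) ∧ ∀ i < n, move σ τ i ≠ move σ τ n := by
  have hf := exists_free (l := hist σ τ n) (by rwa [hist_len])
  have : move σ τ n ∈ (completeBipartiteGraph X Y).edgeSet ∧ move σ τ n ∉ hist σ τ n := by
    unfold move
    split_ifs
    · exact hσ _ hf
    · exact hτ _ hf
  refine ⟨(mem_edge _).1 this.1, ?_⟩
  intro i hi h
  exact this.2 ((mem_hist _ _ _ _).2 ⟨i, hi, h⟩)

theorem star_adj (m : ℕ) (a b : Fin (m + 1)) :
    (AchievementGame.star m).Adj a b ↔ a ≠ b ∧ (a = 0 ∨ b = 0) := by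
  simp [AchievementGame.star, SimpleGraph.fromRel_adj]

theorem hasCopy_of_star {m : ℕ} {S : Finset (X × Y)} (h : StarP m S) {S' : Set (Sym2 (X ⊕ Y))}
    (hS : ∀ p ∈ S, emb p ∈ S') : HasCopy (AchievementGame.star m) S' := by
  have main : ∀ (c : X ⊕ Y) (g : Fin m → X ⊕ Y), Function.Injective g → (∀ i, g i ≠ c) →
      (∀ i, s(c, g i) ∈ S') → HasCopy (AchievementGame.star m) S' := by
    intro c g hg hc hm
    refine ⟨⟨Fin.cons c g, ?_⟩, ?_⟩
    · rw [Fin.cons_injective_iff]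
      refine ⟨?_, hg⟩
      rintro ⟨i, hi⟩; exact hc i hi
    · intro a b hab
      rw [star_adj] at hab
      obtain ⟨hne, h⟩ := hab
      rcases h with rfl | rfl
      · obtain ⟨j, rfl⟩ := Fin.exists_succ_eq.2 hne.symm
        exact hm j
      · obtain ⟨j, rfl⟩ := Fin.exists_succ_eq.2 hne
        rw [Sym2.eq_swap]; exact hm j
  rcases h with ⟨x, hx⟩ | ⟨y, hy⟩
  · obtain ⟨t, ht, htc⟩ := Finset.exists_subset_card_eq hx
    let g := (t.equivFinOfCardEq htc).symm
    refine main (Sum.inl x) (fun i => Sum.inr (g i).1) ?_ (by simp) ?_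
    · intro i j h; exact g.injective (Subtype.ext (by simpa using h))
    · intro i
      have := ht (g i).2
      simp only [Finset.mem_filter, Finset.mem_univ, true_and] at this
      exact hS _ this
  · obtain ⟨t, ht, htc⟩ := Finset.exists_subset_card_eq hy
    let g := (t.equivFinOfCardEq htc).symm
    refine main (Sum.inr y) (fun i => Sum.inl (g i).1) ?_ (by simp) ?_
    · intro i j h; exact g.injective (Subtype.ext (by simpa using h))
    · intro i
      have := ht (g i).2
      simp only [Finset.mem_filter, Finset.mem_univ, true_and] at this
      rw [Sym2.eq_swap]
      exact hS _ this

theorem star_of_hasCopy {m : ℕ} {S : Finset (X × Y)} {S' : Set (Sym2 (X ⊕ Y))}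
    (h : HasCopy (AchievementGame.star m) S') (hS : ∀ e ∈ S', ∃ p ∈ S, e = emb p) :
    StarP m S := by
  obtain ⟨f, hf⟩ := h
  have hm : ∀ i : Fin m, ∃ p ∈ S, s(f 0, f i.succ) = emb p := fun i =>
    hS _ (hf _ _ ((star_adj _ _ _).2 ⟨(Fin.succ_ne_zero i).symm, Or.inl rfl⟩))
  have hinj : ∀ i j : Fin m, f i.succ = f j.succ → i = j := by
    intro i j h; exact Fin.succ_injective _ (f.injective h)
  rcases h0 : f 0 with x | y
  · left
    refine ⟨x, ?_⟩
    have : ∀ i : Fin m, ∃ y, (x, y) ∈ S ∧ f i.succ = Sum.inr y := by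
      intro i
      obtain ⟨⟨a, b⟩, hp, he⟩ := hm i
      rw [h0] at he
      simp only [emb, Sym2.eq_iff, Sum.inl.injEq, reduceCtorEq, false_and, or_false] at he
      exact ⟨b, he.1 ▸ hp, he.2⟩
    choose g hg using this
    have h1 := Finset.card_le_card_of_injOn (s := (Finset.univ : Finset (Fin m)))
      (t := Finset.univ.filter fun y => (x, y) ∈ S) g
      (by intro i _; simpa using (hg i).1)
      (by intro i _ j _ h; apply hinj; rw [(hg i).2, (hg j).2, h])
    simpa [rowc] using h1
  · right
    refine ⟨y, ?_⟩
    have : ∀ i : Fin m, ∃ x, (x, y) ∈ S ∧ f i.succ = Sum.inl x := by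
      intro i
      obtain ⟨⟨a, b⟩, hp, he⟩ := hm i
      rw [h0] at he
      simp only [emb, Sym2.eq_iff, Sum.inr.injEq, reduceCtorEq, false_and, false_or] at he
      exact ⟨a, he.1 ▸ hp, he.2⟩
    choose g hg using this
    have h1 := Finset.card_le_card_of_injOn (s := (Finset.univ : Finset (Fin m)))
      (t := Finset.univ.filter fun x => (x, y) ∈ S) g
      (by intro i _; simpa using (hg i).1)
      (by intro i _ j _ h; apply hinj; rw [(hg i).2, (hg j).2, h])
    simpa [colc] using h1

open Classical in
/-- Pairs played at positions `≡ r mod 2`. -/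
noncomputable def colOf (r : ℕ) (l : List (Sym2 (X ⊕ Y))) : Finset (X × Y) :=
  Finset.univ.filter fun p => ∃ i, l[2 * i + r]? = some (emb p)

theorem mem_colOf (σ τ : Strategy (X ⊕ Y)) (r n : ℕ) (p : X × Y) :
    p ∈ colOf r (hist σ τ n) ↔ ∃ i, 2 * i + r < n ∧ move σ τ (2 * i + r) = emb p := by
  unfold colOf
  simp only [Finset.mem_filter, Finset.mem_univ, true_and]
  refine exists_congr fun i => ?_
  constructor
  · intro h
    have hlt : 2 * i + r < n := by
      have := (List.getElem?_eq_some_iff.1 h).1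
      rwa [hist_len] at this
    rw [hist_get _ _ _ _ hlt] at h
    exact ⟨hlt, by simpa using h⟩
  · rintro ⟨h1, h2⟩
    rw [hist_get _ _ _ _ h1, h2]

theorem mem_hist_iff (σ τ : Strategy (X ⊕ Y)) (n : ℕ) (p : X × Y) :
    emb p ∈ hist σ τ n ↔ p ∈ colOf 0 (hist σ τ n) ∨ p ∈ colOf 1 (hist σ τ n) := by
  rw [mem_hist, mem_colOf, mem_colOf]
  constructor
  · rintro ⟨i, hi, h⟩
    rcases Nat.even_or_odd' i with ⟨j, rfl | rfl⟩
    · exact Or.inl ⟨j, hi, h⟩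
    · exact Or.inr ⟨j, hi, h⟩
  · rintro (⟨i, hi, h⟩ | ⟨i, hi, h⟩)
    · exact ⟨_, hi, h⟩
    · exact ⟨_, hi, h⟩

theorem colOf_succ (σ τ : Strategy (X ⊕ Y)) (r n : ℕ) (p : X × Y) (hp : move σ τ n = emb p) :
    colOf r (hist σ τ (n + 1)) =
      if r ≤ n ∧ n % 2 = r % 2 then insert p (colOf r (hist σ τ n)) else colOf r (hist σ τ n) := by
  ext q
  split_ifs with h
  · rw [Finset.mem_insert, mem_colOf, mem_colOf]
    constructor
    · rintro ⟨i, hi, hq⟩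
      by_cases hin : 2 * i + r = n
      · left; rw [hin, hp] at hq; exact emb_inj hq.symm
      · right; exact ⟨i, by omega, hq⟩
    · rintro (rfl | ⟨i, hi, hq⟩)
      · refine ⟨(n - r) / 2, by omega, ?_⟩
        rw [← hp]; congr 1; omega
      · exact ⟨i, by omega, hq⟩
  · rw [mem_colOf, mem_colOf]
    constructor
    · rintro ⟨i, hi, hq⟩
      exact ⟨i, by omega, hq⟩
    · rintro ⟨i, hi, hq⟩
      exact ⟨i, by omega, hq⟩

theorem lt_of_free {σ τ : Strategy (X ⊕ Y)} (hσ : Strategy.Valid (completeBipartiteGraph X Y) σ)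
    (hτ : Strategy.Valid (completeBipartiteGraph X Y) τ) {n : ℕ} (hn : n ≤ Fintype.card (X × Y))
    {p : X × Y} (hp : emb p ∉ hist σ τ n) : n < Fintype.card (X × Y) := by
  classical
  have h : ∀ i : Fin n, ∃ q : X × Y, move σ τ i = emb q := fun i =>
    (move_legal hσ hτ (lt_of_lt_of_le i.2 hn)).1
  choose g hg using h
  have hinj : Function.Injective g := by
    intro i j hij
    have he : move σ τ i = move σ τ j := by rw [hg, hg, hij]
    rcases lt_trichotomy i.1 j.1 with h | h | h
    · exact absurd he ((move_legal hσ hτ (lt_of_lt_of_le j.2 hn)).2 _ h)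
    · exact Fin.ext h
    · exact absurd he.symm ((move_legal hσ hτ (lt_of_lt_of_le i.2 hn)).2 _ h)
  have h1 : Finset.univ.image g ⊆ Finset.univ.erase p := by
    intro q hq
    simp only [Finset.mem_image, Finset.mem_univ, true_and] at hq
    obtain ⟨i, rfl⟩ := hq
    simp only [Finset.mem_erase, Finset.mem_univ, and_true]
    rintro rfl
    exact hp ((mem_hist _ _ _ _).2 ⟨i, i.2, hg i⟩)
  have h2 := Finset.card_le_card h1
  rw [Finset.card_image_of_injective _ hinj, Finset.card_erase_of_mem (Finset.mem_univ _),
    Finset.card_univ, Finset.card_univ, Fintype.card_fin] at h2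
  have : 0 < Fintype.card (X × Y) := Fintype.card_pos_iff.2 ⟨p⟩
  omega

open Classical in
/-- Alice's strategy. -/
noncomputable def aliceStrat (m : ℕ) (d : Sym2 (X ⊕ Y)) : Strategy (X ⊕ Y) := fun l =>
  if h : ∃ p : X × Y, emb p ∉ l ∧ BWin m (insert p (colOf 0 l)) (colOf 1 l) then emb h.choose
  else if h : ∃ e ∈ (completeBipartiteGraph X Y).edgeSet, e ∉ l then h.choose else d

theorem alice_pos (m : ℕ) (d : Sym2 (X ⊕ Y)) (l : List (Sym2 (X ⊕ Y)))
    (h : ∃ p : X × Y, emb p ∉ l ∧ BWin m (insert p (colOf 0 l)) (colOf 1 l)) :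
    aliceStrat m d l = emb h.choose := dif_pos h

theorem alice_valid (m : ℕ) (d : Sym2 (X ⊕ Y)) :
    Strategy.Valid (completeBipartiteGraph X Y) (aliceStrat m d) := by
  intro l hl
  unfold aliceStrat
  by_cases h : ∃ p : X × Y, emb p ∉ l ∧ BWin m (insert p (colOf 0 l)) (colOf 1 l)
  · rw [dif_pos h]
    exact ⟨(mem_edge _).2 ⟨_, rfl⟩, h.choose_spec.1⟩
  · rw [dif_neg h, dif_pos hl]
    exact hl.choose_spec

theorem alice_wins {m : ℕ} (hm : 2 ≤ m) (x : X) (y : Y) (h : BWin m {(x, y)} (∅ : Finset (X × Y))) :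
    AliceWins (AchievementGame.star m) (completeBipartiteGraph X Y) := by
  refine ⟨aliceStrat m (emb (x, y)), alice_valid _ _, ?_⟩
  intro τ hτ
  have hσ := alice_valid (X := X) (Y := Y) m (emb (x, y))
  set σ := aliceStrat m (emb (x, y)) with hσd
  rw [edge_card]
  have key : ∀ n k : ℕ, Fintype.card (X × Y) ≤ n + k → 2 * k ≤ Fintype.card (X × Y) →
      ¬ StarP m (colOf 1 (hist σ τ (2 * k))) →
      (∃ p : X × Y, emb p ∉ hist σ τ (2 * k) ∧
        BWin m (insert p (colOf 0 (hist σ τ (2 * k)))) (colOf 1 (hist σ τ (2 * k)))) →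
      ∃ k : ℕ, 2 * k + 1 ≤ Fintype.card (X × Y) ∧
      HasCopy (AchievementGame.star m) {e | ∃ i ≤ k, e = move σ τ (2 * i)} ∧
      ¬ HasCopy (AchievementGame.star m) {e | ∃ i < k, e = move σ τ (2 * i + 1)} := by
    intro n
    induction n with
    | zero =>
      intro k h1 h2 _ ⟨p, hp, _⟩
      have := lt_of_free hσ hτ h2 hp
      omega
    | succ n ih =>
      intro k h1 h2 hns hp
      have hlt : 2 * k < Fintype.card (X × Y) := lt_of_free hσ hτ h2 hp.choose_spec.1
      have hmv : move σ τ (2 * k) = emb hp.choose := by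
        unfold move
        rw [if_pos (by omega)]
        exact alice_pos m (emb (x, y)) _ hp
      obtain ⟨hp1, hp2⟩ := hp.choose_spec
      set p := hp.choose
      have hc0 := colOf_succ σ τ 0 (2 * k) p hmv
      rw [if_pos (by omega)] at hc0
      have hc1 := colOf_succ σ τ 1 (2 * k) p hmv
      rw [if_neg (by omega)] at hc1
      rw [← hc0, ← hc1] at hp2
      rw [← hc1] at hns
      cases hp2 with
      | won _ _ hs =>
        refine ⟨k, by omega, hasCopy_of_star hs ?_, ?_⟩
        · intro q hq
          rw [mem_colOf] at hq
          obtain ⟨i, hi, hq⟩ := hq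
          exact ⟨i, by omega, hq.symm⟩
        · intro hc
          apply hns
          refine star_of_hasCopy hc ?_
          rintro e ⟨i, hi, rfl⟩
          obtain ⟨q, hq⟩ := (move_legal hσ hτ (n := 2 * i + 1) (by omega)).1
          exact ⟨q, (mem_colOf _ _ _ _ _).2 ⟨i, by omega, hq⟩, hq⟩
      | step _ _ g hex hs hg hw =>
        have hfr : ∀ f, emb f ∉ hist σ τ (2 * k + 1) ↔
            f ∉ colOf 0 (hist σ τ (2 * k + 1)) ∧ f ∉ colOf 1 (hist σ τ (2 * k + 1)) := by
          intro f; rw [mem_hist_iff, not_or]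
        obtain ⟨f0, hf0⟩ := hex
        have hlt2 : 2 * k + 1 < Fintype.card (X × Y) :=
          lt_of_free hσ hτ (by omega) ((hfr f0).2 hf0)
        obtain ⟨⟨f, hf⟩, hfn⟩ := move_legal hσ hτ hlt2
        have hfh : emb f ∉ hist σ τ (2 * k + 1) := by
          rw [mem_hist]
          rintro ⟨i, hi, h⟩
          exact hfn i hi (h.trans hf.symm)
        obtain ⟨hf1, hf2⟩ := (hfr f).1 hfh
        have hd0 := colOf_succ σ τ 0 (2 * k + 1) f hf
        rw [if_neg (by omega)] at hd0
        have hd1 := colOf_succ σ τ 1 (2 * k + 1) f hf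
        rw [if_pos (by omega)] at hd1
        have e1 : 2 * (k + 1) = 2 * k + 1 + 1 := by ring
        apply ih (k + 1) (by omega) (by omega)
        · rw [e1, hd1]; exact hs f hf1 hf2
        · refine ⟨g f, ?_, ?_⟩
          · rw [e1, mem_hist_iff, hd0, hd1, Finset.mem_insert]
            have := hg f hf1 hf2
            tauto
          · rw [e1, hd0, hd1]; exact hw f hf1 hf2
  have hz : ∀ r, colOf r (hist σ τ (2 * 0)) = (∅ : Finset (X × Y)) := by
    intro r; ext p; rw [mem_colOf]; simp
  apply key (Fintype.card (X × Y)) 0 (by omega) (by omega)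
  · rw [hz]
    rintro (⟨x, h⟩ | ⟨x, h⟩)
    · simp [rowc] at h; omega
    · simp [colc] at h; omega
  · refine ⟨(x, y), by simp [hist], ?_⟩
    rw [hz, hz]; exact h

open Classical in
/-- Bob's pairing strategy. -/
noncomputable def bobStrat (π : X → X) (d : Sym2 (X ⊕ Y)) : Strategy (X ⊕ Y) := fun l =>
  if h : ∃ p : X × Y, l.getLast? = some (emb p) ∧ emb (π p.1, p.2) ∉ l then
    emb (π h.choose.1, h.choose.2)
  else if h : ∃ e ∈ (completeBipartiteGraph X Y).edgeSet, e ∉ l then h.choose else d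

theorem bob_pos (π : X → X) (d : Sym2 (X ⊕ Y)) (l : List (Sym2 (X ⊕ Y)))
    (h : ∃ p : X × Y, l.getLast? = some (emb p) ∧ emb (π p.1, p.2) ∉ l) :
    bobStrat π d l = emb (π h.choose.1, h.choose.2) := dif_pos h

theorem bob_valid (π : X → X) (d : Sym2 (X ⊕ Y)) :
    Strategy.Valid (completeBipartiteGraph X Y) (bobStrat π d) := by
  intro l hl
  unfold bobStrat
  by_cases h : ∃ p : X × Y, l.getLast? = some (emb p) ∧ emb (π p.1, p.2) ∉ l
  · rw [dif_pos h]
    exact ⟨(mem_edge _).2 ⟨_, rfl⟩, h.choose_spec.2⟩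
  · rw [dif_neg h, dif_pos hl]
    exact hl.choose_spec

theorem bob_draws {m : ℕ} (hX : Fintype.card X + 2 = 2 * m) (hY : Fintype.card Y < m)
    (d : Sym2 (X ⊕ Y)) (π : X → X) (hπ : ∀ x, π (π x) = x) (hπ' : ∀ x, π x ≠ x) :
    ¬ AliceWins (AchievementGame.star m) (completeBipartiteGraph X Y) := by
  rintro ⟨σ, hσ, hw⟩
  have hτ := bob_valid (X := X) (Y := Y) π d
  obtain ⟨k, hk, hc, -⟩ := hw _ hτ
  set τ := bobStrat π d with hτd
  rw [edge_card] at hk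
  have key : ∀ i, 2 * i < Fintype.card (X × Y) → ∀ p : X × Y, move σ τ (2 * i) = emb p →
      move σ τ (2 * i + 1) = emb (π p.1, p.2) := by
    intro i
    induction i using Nat.strong_induction_on with
    | _ i ih =>
      intro hi p hp
      have hlast : (hist σ τ (2 * i + 1)).getLast? = some (emb p) := by
        rw [hist_succ, hp]; simp
      have hnot : emb (π p.1, p.2) ∉ hist σ τ (2 * i + 1) := by
        rw [mem_hist]
        rintro ⟨j, hj, h⟩
        have hnew := (move_legal hσ hτ hi).2
        by_cases hji : j = 2 * i
        · subst hji
          rw [hp] at h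
          have := congrArg Prod.fst (emb_inj h)
          exact hπ' _ this.symm
        · rcases Nat.even_or_odd' j with ⟨t, rfl | rfl⟩
          · have h2 := ih t (by omega) (by omega) _ h
            simp only [hπ] at h2
            exact hnew (2 * t + 1) (by omega) (h2.trans hp.symm)
          · obtain ⟨q, hq⟩ := (move_legal hσ hτ (n := 2 * t) (by omega)).1
            have h2 := ih t (by omega) (by omega) _ hq
            have h3 := emb_inj (h.symm.trans h2)
            simp only [Prod.mk.injEq] at h3
            have h4 : p = q := by
              apply Prod.ext
              · rw [← hπ p.1, h3.1, hπ]
              · exact h3.2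
            subst h4
            exact hnew (2 * t) (by omega) (hq.trans hp.symm)
      have hex : ∃ p : X × Y, (hist σ τ (2 * i + 1)).getLast? = some (emb p) ∧
          emb (π p.1, p.2) ∉ hist σ τ (2 * i + 1) := ⟨p, hlast, hnot⟩
      have hmv : move σ τ (2 * i + 1) = emb (π hex.choose.1, hex.choose.2) := by
        unfold move
        rw [if_neg (by omega)]
        exact bob_pos π d _ hex
      have hch : hex.choose = p := by
        exact (emb_inj (Option.some.inj (hlast.symm.trans hex.choose_spec.1))).symm
      rw [hmv, hch]
  have hS : StarP m (colOf 0 (hist σ τ (2 * k + 1))) := by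
    refine star_of_hasCopy hc ?_
    rintro e ⟨i, hi, rfl⟩
    obtain ⟨q, hq⟩ := (move_legal hσ hτ (n := 2 * i) (by omega)).1
    exact ⟨q, (mem_colOf _ _ _ _ _).2 ⟨i, by omega, hq⟩, hq⟩
  have hpair : ∀ p, p ∈ colOf 0 (hist σ τ (2 * k + 1)) →
      (π p.1, p.2) ∉ colOf 0 (hist σ τ (2 * k + 1)) := by
    intro p hp hp'
    rw [mem_colOf] at hp hp'
    obtain ⟨i, hi, h1⟩ := hp
    obtain ⟨j, hj, h2⟩ := hp'
    simp only [add_zero] at h1 h2 hi hj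
    rcases lt_trichotomy i j with hij | rfl | hij
    · have h3 := key i (by omega) p h1
      exact (move_legal hσ hτ (n := 2 * j) (by omega)).2 (2 * i + 1) (by omega) (h3.trans h2.symm)
    · have := congrArg Prod.fst (emb_inj (h1.symm.trans h2))
      exact hπ' _ this.symm
    · have h3 := key j (by omega) _ h2
      simp only [hπ] at h3
      exact (move_legal hσ hτ (n := 2 * i) (by omega)).2 (2 * j + 1) (by omega) (h3.trans h1.symm)
  rcases hS with ⟨x, hx⟩ | ⟨y, hy⟩
  · have : rowc (colOf 0 (hist σ τ (2 * k + 1))) x ≤ Fintype.card Y := Finset.card_le_univ _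
    omega
  · have hdis : 2 * colc (colOf 0 (hist σ τ (2 * k + 1))) y ≤ Fintype.card X := by
      unfold colc
      set A := Finset.univ.filter fun x => (x, y) ∈ colOf 0 (hist σ τ (2 * k + 1)) with hA
      have hinj : Function.Injective π := fun a b h => by rw [← hπ a, h, hπ]
      have h1 : Disjoint A (A.image π) := by
        rw [Finset.disjoint_left]
        intro a ha hb
        obtain ⟨b, hbA, rfl⟩ := Finset.mem_image.1 hb
        exact hpair (b, y) (Finset.mem_filter.1 hbA).2 (Finset.mem_filter.1 ha).2
      have h2 := Finset.card_le_univ (A ∪ A.image π)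
      rw [Finset.card_union_of_disjoint h1, Finset.card_image_of_injective _ hinj] at h2
      omega
    omega

end Bridge

end StarProof

open AchievementGame

/-- Let `m ≥ 2` and let `n₂` be an integer with `1 ≤ n₂ ≤ 2m − 2`. Alice has a winning
strategy in the achievement game `(K_{1,m}, K_{2m-2,n₂}, +)` if and only if `n₂ ≥ m`. -/
theorem stmt15 (m n₂ : ℕ) (hm : 2 ≤ m) (h₁ : 1 ≤ n₂) (h₂ : n₂ ≤ 2 * m - 2) :
    AliceWins (star m) (completeBipartiteGraph (Fin (2 * m - 2)) (Fin n₂)) ↔ m ≤ n₂ := by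
  constructor
  · intro h
    by_contra hlt
    refine StarProof.bob_draws (m := m) (by rw [Fintype.card_fin]; omega)
      (by rw [Fintype.card_fin]; omega)
      (StarProof.emb (⟨0, by omega⟩, ⟨0, by omega⟩))
      (fun x => ⟨if x.1 % 2 = 0 then x.1 + 1 else x.1 - 1, by have := x.2; split_ifs <;> omega⟩)
      ?_ ?_ h
    · intro x; apply Fin.ext; simp only; split_ifs <;> omega
    · intro x h
      have := congrArg Fin.val h
      simp only at this
      split_ifs at this <;> omega
  · intro h
    exact StarProof.alice_wins hm ⟨0, by omega⟩ ⟨0, by omega⟩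
      (StarProof.start hm (by rw [Fintype.card_fin]; omega) (by rw [Fintype.card_fin]; omega)
        (by rw [Fintype.card_fin]; omega) _ _)
end

section
/- For every integer m ≥ 4, Alice has a winning strategy in the achievement game (K_{1,m}, K_{2m-3, 2m-3}, +) played on the complete bipartite graph with both parts of size 2m − 3. -/
namespace AchievementGame

section Abstract

variable {V : Type} [DecidableEq V]

/-- Number of edges of `S` at `v`. -/
def dg (S : Finset (Sym2 V)) (v : V) : ℕ := (S.filter (fun e => v ∈ e)).card

/-- Uncolored edges. -/
def fr (E A B : Finset (Sym2 V)) : Finset (Sym2 V) := E \ (A ∪ B)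

/-- Alice, to move, wins. -/
inductive AW (E : Finset (Sym2 V)) (m : ℕ) : Finset (Sym2 V) → Finset (Sym2 V) → Prop
  | now (A B : Finset (Sym2 V)) (e : Sym2 V) (he : e ∈ fr E A B)
      (h1 : ∃ v, m ≤ dg (insert e A) v) (h2 : ∀ v, dg B v < m) : AW E m A B
  | step (A B : Finset (Sym2 V)) (e : Sym2 V) (he : e ∈ fr E A B)
      (h0 : ∃ f, f ∈ fr E (insert e A) B)
      (h : ∀ f, f ∈ fr E (insert e A) B → AW E m (insert e A) (insert f B)) : AW E m A B

/-- Bob, to move, loses. -/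
def BW (E : Finset (Sym2 V)) (m : ℕ) (A B : Finset (Sym2 V)) : Prop :=
  (∃ f, f ∈ fr E A B) ∧ ∀ f, f ∈ fr E A B → AW E m A (insert f B)

lemma AW.of_BW {E : Finset (Sym2 V)} {m : ℕ} {A B : Finset (Sym2 V)} {e : Sym2 V}
    (he : e ∈ fr E A B) (h : BW E m (insert e A) B) : AW E m A B :=
  AW.step A B e he h.1 h.2

lemma mem_fr {E A B : Finset (Sym2 V)} {e : Sym2 V} :
    e ∈ fr E A B ↔ e ∈ E ∧ e ∉ A ∧ e ∉ B := by
  simp [fr]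

lemma dg_insert {S : Finset (Sym2 V)} {e : Sym2 V} (he : e ∉ S) (v : V) :
    dg (insert e S) v = dg S v + if v ∈ e then 1 else 0 := by
  unfold dg
  rw [Finset.filter_insert]
  split_ifs
  · rw [Finset.card_insert_of_notMem]
    simp [he]
  · rfl

lemma dg_insert_le (S : Finset (Sym2 V)) (e : Sym2 V) (v : V) :
    dg (insert e S) v ≤ dg S v + if v ∈ e then 1 else 0 := by
  by_cases he : e ∈ S
  · rw [Finset.insert_eq_of_mem he]; omega
  · rw [dg_insert he]

lemma count {E A B : Finset (Sym2 V)} (hA : A ⊆ E) (hB : B ⊆ E) (hd : Disjoint A B) (v : V) :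
    dg A v + dg B v + dg (fr E A B) v = dg E v := by
  unfold dg
  rw [← Finset.card_union_of_disjoint, ← Finset.card_union_of_disjoint]
  · congr 1
    ext e
    simp only [Finset.mem_union, Finset.mem_filter, mem_fr]
    have := @hA e
    have := @hB e
    tauto
  · rw [Finset.disjoint_left]
    intro e
    simp only [Finset.mem_union, Finset.mem_filter, mem_fr]
    tauto
  · rw [Finset.disjoint_left] at *
    intro e
    simp only [Finset.mem_filter]
    have := @hd e
    tauto

lemma exists_free {E A B : Finset (Sym2 V)} (hA : A ⊆ E) (hB : B ⊆ E) (hd : Disjoint A B) {v : V}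
    (h : dg A v + dg B v < dg E v) : ∃ e ∈ fr E A B, v ∈ e := by
  have h1 := count hA hB hd v
  have : 0 < dg (fr E A B) v := by omega
  unfold dg at this
  obtain ⟨e, he⟩ := Finset.card_pos.1 this
  rw [Finset.mem_filter] at he
  exact ⟨e, he⟩

/-- number of uncolored edges from `w` to guards -/
def fg (E : Finset (Sym2 V)) (Γ : Finset V) (A B : Finset (Sym2 V)) (w : V) : ℕ :=
  (Γ.filter (fun g => s(g, w) ∈ fr E A B)).card

lemma fg_mono {E : Finset (Sym2 V)} {Γ : Finset V} {A B A' B' : Finset (Sym2 V)} (w : V)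
    (h : fr E A' B' ⊆ fr E A B) : fg E Γ A' B' w ≤ fg E Γ A B w := by
  unfold fg
  apply Finset.card_le_card
  intro g
  simp only [Finset.mem_filter]
  exact fun hg => ⟨hg.1, h hg.2⟩

lemma fr_sub {E A B A' B' : Finset (Sym2 V)} (hA : A ⊆ A') (hB : B ⊆ B') :
    fr E A' B' ⊆ fr E A B := by
  intro e
  simp only [mem_fr]
  have := @hA e
  have := @hB e
  tauto

/-- A colouring position. -/
structure Pos (E A B : Finset (Sym2 V)) : Prop where
  hA : A ⊆ E
  hB : B ⊆ E
  hd : Disjoint A B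

lemma Pos.insA {E A B : Finset (Sym2 V)} (h : Pos E A B) {e : Sym2 V} (he : e ∈ fr E A B) :
    Pos E (insert e A) B := by
  rw [mem_fr] at he
  refine ⟨Finset.insert_subset he.1 h.hA, h.hB, ?_⟩
  rw [Finset.disjoint_insert_left]
  exact ⟨he.2.2, h.hd⟩

lemma Pos.insB {E A B : Finset (Sym2 V)} (h : Pos E A B) {e : Sym2 V} (he : e ∈ fr E A B) :
    Pos E A (insert e B) := by
  rw [mem_fr] at he
  refine ⟨h.hA, Finset.insert_subset he.1 h.hB, ?_⟩
  rw [Finset.disjoint_insert_right]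
  exact ⟨he.2.1, h.hd⟩

structure Inv (E : Finset (Sym2 V)) (m : ℕ) (c : V) (Γ : Finset V) (A B : Finset (Sym2 V)) :
    Prop where
  pos : Pos E A B
  hc : dg B c + 3 ≤ dg A c
  hcm : dg A c < m
  hgc : ∀ g ∈ Γ, g ≠ c ∧ s(g, c) ∉ fr E A B
  hgg : ∀ g ∈ Γ, ∀ g' ∈ Γ, s(g, g') ∉ fr E A B
  hg : ∀ g ∈ Γ, dg B g ≤ dg A g ∨ (dg B g < m ∧ ∀ e ∈ fr E A B, g ∉ e)
  hw : ∀ w, w ∉ Γ → w ≠ c → dg B w + fg E Γ A B w < dg A c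

theorem main_win {E : Finset (Sym2 V)} {m : ℕ} (hm : 4 ≤ m) (hE : ∀ v, dg E v = 2 * m - 3)
    {c : V} {Γ : Finset V} (N : ℕ) : ∀ A B : Finset (Sym2 V), (fr E A B).card ≤ N →
    Inv E m c Γ A B → BW E m A B := by
  induction N with
  | zero =>
    intro A B hN h
    exfalso
    obtain ⟨e, he, -⟩ := exists_free h.pos.hA h.pos.hB h.pos.hd (v := c)
      (by rw [hE]; have := h.hc; have := h.hcm; omega)
    rw [Finset.card_eq_zero.1 (Nat.le_zero.1 hN)] at he
    simp at he
  | succ N ih =>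
    intro A B hN h
    refine ⟨?_, ?_⟩
    · obtain ⟨e, he, -⟩ := exists_free h.pos.hA h.pos.hB h.pos.hd (v := c)
        (by rw [hE]; have := h.hc; have := h.hcm; omega)
      exact ⟨e, he⟩
    intro f hf
    have hP := h.pos.insB hf
    have hfB : f ∉ B := (mem_fr.1 hf).2.2
    have hs1 : fr E A (insert f B) ⊆ fr E A B :=
      fr_sub (Finset.Subset.refl _) (Finset.subset_insert _ _)
    have hlt : (fr E A (insert f B)).card < (fr E A B).card := by
      apply Finset.card_lt_card
      refine ⟨hs1, fun hcon => ?_⟩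
      have := hcon hf
      simp [mem_fr] at this
    have hc := h.hc
    have hcm := h.hcm
    by_cases hcase : ∃ g ∈ Γ, g ∈ f ∧ ∃ e ∈ fr E A (insert f B), g ∈ e
    · obtain ⟨g, hgΓ, hgf, e, he, hge⟩ := hcase
      have hs2 : fr E (insert e A) (insert f B) ⊆ fr E A (insert f B) :=
        fr_sub (Finset.subset_insert _ _) (Finset.Subset.refl _)
      have heA : e ∉ A := (mem_fr.1 he).2.1
      obtain ⟨hgc1, hgc2⟩ := h.hgc g hgΓ
      have hcf : c ∉ f := by
        intro hcf
        rw [(Sym2.mem_and_mem_iff hgc1).1 ⟨hgf, hcf⟩] at hf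
        exact hgc2 hf
      have hce : c ∉ e := by
        intro hcf
        rw [(Sym2.mem_and_mem_iff hgc1).1 ⟨hge, hcf⟩] at he
        exact hgc2 (hs1 he)
      have hAc : dg (insert e A) c = dg A c := by rw [dg_insert heA]; simp [hce]
      have hBc : dg (insert f B) c = dg B c := by rw [dg_insert hfB]; simp [hcf]
      refine AW.of_BW he (ih _ _ ?_ ?_)
      · have := Finset.card_le_card hs2
        omega
      · refine ⟨hP.insA he, by omega, by omega, ?_, ?_, ?_, ?_⟩
        · exact fun g' hg' => ⟨(h.hgc g' hg').1, fun hh => (h.hgc g' hg').2 (hs1 (hs2 hh))⟩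
        · exact fun g' hg' g'' hg'' hh => h.hgg g' hg' g'' hg'' (hs1 (hs2 hh))
        · intro g' hg'
          by_cases hgg' : g' = g
          · subst hgg'
            rcases h.hg g' hg' with h1 | h1
            · left
              rw [dg_insert heA, dg_insert hfB]
              simp [hge, hgf, h1]
            · exact absurd hgf (h1.2 f hf)
          · have hgf' : g' ∉ f := by
              intro hh
              rw [(Sym2.mem_and_mem_iff (Ne.symm hgg')).1 ⟨hgf, hh⟩] at hf
              exact h.hgg g hgΓ g' hg' hf
            have e1 : dg (insert f B) g' = dg B g' := by rw [dg_insert hfB]; simp [hgf']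
            have e2 : dg A g' ≤ dg (insert e A) g' := by rw [dg_insert heA]; omega
            rcases h.hg g' hg' with h1 | h1
            · left; omega
            · right
              exact ⟨by omega, fun e' he' => h1.2 e' (hs1 (hs2 he'))⟩
        · intro w hwΓ hwc
          have h1 := h.hw w hwΓ hwc
          have h2 := fg_mono (Γ := Γ) w (hs2.trans hs1)
          rw [hAc, dg_insert hfB]
          by_cases hwf : w ∈ f
          · have hgw : g ≠ w := fun hh => hwΓ (hh ▸ hgΓ)
            have hfe : f = s(g, w) := (Sym2.mem_and_mem_iff hgw).1 ⟨hgf, hwf⟩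
            have : fg E Γ (insert e A) (insert f B) w < fg E Γ A B w := by
              unfold fg
              apply Finset.card_lt_card
              refine ⟨?_, fun hcon => ?_⟩
              · intro x
                simp only [Finset.mem_filter]
                exact fun hx => ⟨hx.1, hs1 (hs2 hx.2)⟩
              · have h3 : g ∈ Γ.filter (fun g => s(g, w) ∈ fr E A B) := by
                  rw [Finset.mem_filter]
                  exact ⟨hgΓ, hfe ▸ hf⟩
                have h4 := hcon h3
                rw [Finset.mem_filter, mem_fr] at h4
                exact h4.2.2.2 (by rw [hfe]; simp)
            simp only [hwf, if_true]
            omega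
          · simp only [hwf, if_false]
            omega
    · have hBc : dg (insert f B) c ≤ dg B c + 1 := by
        rw [dg_insert hfB]; split_ifs <;> omega
      obtain ⟨e, he, hce⟩ := exists_free hP.hA hP.hB hP.hd (v := c)
        (by rw [hE]; omega)
      have heA : e ∉ A := (mem_fr.1 he).2.1
      have hs2 : fr E (insert e A) (insert f B) ⊆ fr E A (insert f B) :=
        fr_sub (Finset.subset_insert _ _) (Finset.Subset.refl _)
      have hAc : dg (insert e A) c = dg A c + 1 := by rw [dg_insert heA]; simp [hce]
      have hgB : ∀ g ∈ Γ, dg (insert f B) g ≤ dg A g ∨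
          (dg (insert f B) g < m ∧ ∀ e ∈ fr E A (insert f B), g ∉ e) := by
        intro g hg
        have hq := count hP.hA hP.hB hP.hd g
        rw [hE] at hq
        by_cases hgf : g ∈ f
        · rcases h.hg g hg with h1 | h1
          · right
            have e1 : dg (insert f B) g = dg B g + 1 := by rw [dg_insert hfB]; simp [hgf]
            refine ⟨by omega, fun e' he' hge' => hcase ⟨g, hg, hgf, e', he', hge'⟩⟩
          · exact absurd hgf (h1.2 f hf)
        · have e1 : dg (insert f B) g = dg B g := by rw [dg_insert hfB]; simp [hgf]
          rw [e1]
          rcases h.hg g hg with h1 | h1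
          · left; exact h1
          · right; exact ⟨h1.1, fun e' he' => h1.2 e' (hs1 he')⟩
      have hwB : ∀ w, w ∉ Γ → w ≠ c →
          dg (insert f B) w + fg E Γ (insert e A) (insert f B) w < dg A c + 1 := by
        intro w hwΓ hwc
        have h1 := h.hw w hwΓ hwc
        have h2 := fg_mono (Γ := Γ) w (hs2.trans hs1)
        have h3 : dg (insert f B) w ≤ dg B w + 1 := by
          rw [dg_insert hfB]; split_ifs <;> omega
        omega
      by_cases hlast : dg A c + 1 = m
      · refine AW.now _ _ e he ⟨c, by omega⟩ ?_
        intro w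
        by_cases hwc : w = c
        · subst hwc; omega
        by_cases hwΓ : w ∈ Γ
        · have hq := count hP.hA hP.hB hP.hd w
          rw [hE] at hq
          rcases hgB w hwΓ with h1 | h1
          · omega
          · exact h1.1
        · have := hwB w hwΓ hwc
          omega
      · refine AW.of_BW he (ih _ _ ?_ ?_)
        · have := Finset.card_le_card hs2
          omega
        · refine ⟨hP.insA he, by omega, by omega, ?_, ?_, ?_, ?_⟩
          · exact fun g' hg' => ⟨(h.hgc g' hg').1, fun hh => (h.hgc g' hg').2 (hs1 (hs2 hh))⟩
          · exact fun g' hg' g'' hg'' hh => h.hgg g' hg' g'' hg'' (hs1 (hs2 hh))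
          · intro g hg
            have e2 : dg A g ≤ dg (insert e A) g := by rw [dg_insert heA]; omega
            rcases hgB g hg with h1 | h1
            · left; omega
            · right; exact ⟨h1.1, fun e' he' => h1.2 e' (hs2 he')⟩
          · intro w hwΓ hwc
            rw [hAc]
            exact hwB w hwΓ hwc

/-- A threat at `c` with guards `Γ`, Bob to move. -/
structure Pre (E : Finset (Sym2 V)) (m : ℕ) (c : V) (Γ : Finset V) (A B : Finset (Sym2 V)) :
    Prop where
  pos : Pos E A B
  hc : dg B c + 2 ≤ dg A c
  hcm : dg A c < m
  hgc : ∀ g ∈ Γ, g ≠ c ∧ s(g, c) ∉ fr E A B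
  hgg : ∀ g ∈ Γ, ∀ g' ∈ Γ, s(g, g') ∉ fr E A B
  hg : ∀ g ∈ Γ, dg B g + 1 ≤ dg A g
  hw : ∀ w, w ∉ Γ → w ≠ c → dg B w + fg E Γ A B w < dg A c

theorem Pre.decline {E : Finset (Sym2 V)} {m : ℕ} (hm : 4 ≤ m) (hE : ∀ v, dg E v = 2 * m - 3)
    {c : V} {Γ : Finset V} {A B : Finset (Sym2 V)} (h : Pre E m c Γ A B) {f : Sym2 V}
    (hf : f ∈ fr E A B) (hcf : c ∉ f) : AW E m A (insert f B) := by
  have hP := h.pos.insB hf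
  have hfB : f ∉ B := (mem_fr.1 hf).2.2
  have hs1 : fr E A (insert f B) ⊆ fr E A B :=
    fr_sub (Finset.Subset.refl _) (Finset.subset_insert _ _)
  have hc := h.hc
  have hcm := h.hcm
  have hBc : dg (insert f B) c = dg B c := by rw [dg_insert hfB]; simp [hcf]
  obtain ⟨e, he, hce⟩ := exists_free hP.hA hP.hB hP.hd (v := c) (by rw [hE]; omega)
  have heA : e ∉ A := (mem_fr.1 he).2.1
  have hs2 : fr E (insert e A) (insert f B) ⊆ fr E A (insert f B) :=
    fr_sub (Finset.subset_insert _ _) (Finset.Subset.refl _)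
  have hAc : dg (insert e A) c = dg A c + 1 := by rw [dg_insert heA]; simp [hce]
  have hle : ∀ w, dg (insert f B) w ≤ dg B w + 1 := by
    intro w
    rw [dg_insert hfB]; split_ifs <;> omega
  by_cases hlast : dg A c + 1 = m
  · refine AW.now _ _ e he ⟨c, by omega⟩ ?_
    intro w
    have h3 := hle w
    by_cases hwc : w = c
    · subst hwc; omega
    by_cases hwΓ : w ∈ Γ
    · have hq := count hP.hA hP.hB hP.hd w
      rw [hE] at hq
      have := h.hg w hwΓ
      omega
    · have := h.hw w hwΓ hwc
      omega
  · refine AW.of_BW he (main_win hm hE (c := c) (Γ := Γ) _ _ _ le_rfl ?_)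
    refine ⟨hP.insA he, by omega, by omega, ?_, ?_, ?_, ?_⟩
    · exact fun g' hg' => ⟨(h.hgc g' hg').1, fun hh => (h.hgc g' hg').2 (hs1 (hs2 hh))⟩
    · exact fun g' hg' g'' hg'' hh => h.hgg g' hg' g'' hg'' (hs1 (hs2 hh))
    · intro g hg
      have e2 : dg A g ≤ dg (insert e A) g := by rw [dg_insert heA]; omega
      have := h.hg g hg
      have := hle g
      left; omega
    · intro w hwΓ hwc
      have h1 := h.hw w hwΓ hwc
      have h2 := fg_mono (Γ := Γ) w (hs2.trans hs1)
      have h3 := hle w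
      omega

theorem Pre.threat {E : Finset (Sym2 V)} {m : ℕ} (hm : 4 ≤ m) (hE : ∀ v, dg E v = 2 * m - 3)
    {c : V} {Γ : Finset V} {A B : Finset (Sym2 V)} (h : Pre E m c Γ A B)
    (hrep : ∀ w, s(c, w) ∈ fr E A B → AW E m A (insert s(c, w) B)) : BW E m A B := by
  refine ⟨?_, ?_⟩
  · obtain ⟨e, he, -⟩ := exists_free h.pos.hA h.pos.hB h.pos.hd (v := c)
      (by rw [hE]; have := h.hc; have := h.hcm; omega)
    exact ⟨e, he⟩
  · intro f hf
    by_cases hcf : c ∈ f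
    · obtain ⟨w, rfl⟩ := hcf
      exact hrep w hf
    · exact h.decline hm hE hf hcf

end Abstract

end AchievementGame

namespace AchievementGame

section Stages

variable {V : Type} [DecidableEq V]

lemma dg_empty (v : V) : dg (∅ : Finset (Sym2 V)) v = 0 := by simp [dg]

lemma fg_empty (E A B : Finset (Sym2 V)) (w : V) : fg E ∅ A B w = 0 := by simp [fg]

/-- Threat without guards. -/
lemma Pre.simple {E : Finset (Sym2 V)} {m : ℕ} {c : V} {A B : Finset (Sym2 V)}
    (pos : Pos E A B) (hc : dg B c + 2 ≤ dg A c) (hcm : dg A c < m)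
    (hw : ∀ w, w ≠ c → dg B w < dg A c) : Pre E m c ∅ A B := by
  refine ⟨pos, hc, hcm, by simp, by simp, by simp, ?_⟩
  intro w _ hwc
  rw [fg_empty]
  exact hw w hwc

structure Host (V : Type) [DecidableEq V] where
  side : V → Bool
  E : Finset (Sym2 V)
  m : ℕ
  hm : 4 ≤ m
  hEm : ∀ a b, s(a, b) ∈ E ↔ side a ≠ side b
  hE : ∀ v, dg E v = 2 * m - 3
  hfresh : ∀ (b : Bool) (S : Finset V), S.card ≤ 4 → ∃ v, side v = b ∧ v ∉ S

theorem stage6 (H : Host V) {u x x' p p' v y z t t' : V} {b : Bool}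
    (hu : H.side u = b) (hx : H.side x = b) (hx' : H.side x' = b) (hp : H.side p = b)
    (hp' : H.side p' = b) (hv : H.side v = !b) (hy : H.side y = !b) (hz : H.side z = !b)
    (ht : H.side t = !b) (ht' : H.side t' = !b)
    (hL : [u, x, x', p, p'].Nodup) (hR : [v, y, z, t, t'].Nodup)
    (pos : Pos H.E {s(p, z), s(v, p), s(x, z), s(x, y), s(v, x), s(u, v)}
      {s(v, p'), s(x, t'), s(x, t), s(v, x'), s(u, y)}) :
    BW H.E H.m {s(p, z), s(v, p), s(x, z), s(x, y), s(v, x), s(u, v)}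
      {s(v, p'), s(x, t'), s(x, t), s(v, x'), s(u, y)} := by
  have hm := H.hm
  have hLR : ∀ a c, H.side a = b → H.side c = !b → a ≠ c := by
    intro a c h1 h2 h3
    subst h3
    rw [h1] at h2
    cases b <;> simp at h2
  have dA : ∀ w, dg {s(p, z), s(v, p), s(x, z), s(x, y), s(v, x), s(u, v)} w =
      ((((((0 + if w ∈ s(u, v) then 1 else 0) + if w ∈ s(v, x) then 1 else 0)
      + if w ∈ s(x, y) then 1 else 0) + if w ∈ s(x, z) then 1 else 0)
      + if w ∈ s(v, p) then 1 else 0) + if w ∈ s(p, z) then 1 else 0) := by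
    intro w
    rw [dg_insert, dg_insert, dg_insert, dg_insert, dg_insert, ← insert_empty_eq, dg_insert,
      dg_empty]
    all_goals
      simp only [Finset.mem_insert, Finset.mem_singleton, Finset.notMem_empty, Sym2.eq_iff,
        not_false_eq_true]
      try grind
  have dB : ∀ w, dg {s(v, p'), s(x, t'), s(x, t), s(v, x'), s(u, y)} w ≤
      (((((0 + if w ∈ s(u, y) then 1 else 0) + if w ∈ s(v, x') then 1 else 0)
      + if w ∈ s(x, t) then 1 else 0) + if w ∈ s(x, t') then 1 else 0)
      + if w ∈ s(v, p') then 1 else 0) := by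
    intro w
    refine (dg_insert_le _ _ _).trans (Nat.add_le_add_right ?_ _)
    refine (dg_insert_le _ _ _).trans (Nat.add_le_add_right ?_ _)
    refine (dg_insert_le _ _ _).trans (Nat.add_le_add_right ?_ _)
    refine (dg_insert_le _ _ _).trans (Nat.add_le_add_right ?_ _)
    rw [← insert_empty_eq]
    refine (dg_insert_le _ _ _).trans (Nat.add_le_add_right ?_ _)
    rw [dg_empty]
  simp only [Sym2.mem_iff] at dA dB
  simp only [List.nodup_cons, List.mem_cons, List.not_mem_nil, or_false, not_or,
    List.nodup_nil, and_true, not_false_eq_true] at hL hR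
  have hxv : x ≠ v := hLR _ _ hx hv
  obtain ⟨A, hA⟩ : ∃ A : Finset (Sym2 V),
    A = {s(p, z), s(v, p), s(x, z), s(x, y), s(v, x), s(u, v)} := ⟨_, rfl⟩
  obtain ⟨B, hB⟩ : ∃ B : Finset (Sym2 V),
    B = {s(v, p'), s(x, t'), s(x, t), s(v, x'), s(u, y)} := ⟨_, rfl⟩
  rw [← hA] at dA pos ⊢
  rw [← hB] at dB pos ⊢
  have hgg : ∀ g ∈ ({x, v} : Finset V), ∀ g' ∈ ({x, v} : Finset V), s(g, g') ∉ fr H.E A B := by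
    intro g hg g' hg'
    simp only [Finset.mem_insert, Finset.mem_singleton] at hg hg'
    rw [mem_fr, H.hEm]
    rcases hg with rfl | rfl <;> rcases hg' with rfl | rfl <;> simp [hA]
  have c1 := hLR _ _ hx hy
  have c2 := hLR _ _ hx hz
  have c3 := hLR _ _ hx ht
  have c4 := hLR _ _ hx ht'
  have c5 := hLR _ _ hp hv
  have c6 := hLR _ _ hp hy
  have c7 := hLR _ _ hp hz
  have c8 := hLR _ _ hp ht
  have c9 := hLR _ _ hp ht'
  have c10 := hLR _ _ hu hv
  have c11 := hLR _ _ hu hz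
  have c12 := hLR _ _ hx' hv
  have c13 := hLR _ _ hx' hz
  have c14 := hLR _ _ hp' hv
  have c15 := hLR _ _ hp' hz
  obtain ⟨⟨l1, l2, l3, l4⟩, ⟨l5, l6, l7⟩, ⟨l8, l9⟩, l10⟩ := hL
  obtain ⟨⟨r1, r2, r3, r4⟩, ⟨r5, r6, r7⟩, ⟨r8, r9⟩, r10⟩ := hR
  have hzA : dg A z = 2 := by
    rw [dA]; simp [*, Ne.symm, eq_comm]
  have hzB : dg B z = 0 := by
    have := dB z
    have e1 : ¬ (z = u ∨ z = y) := by grind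
    have e2 : ¬ (z = v ∨ z = x') := by grind
    have e3 : ¬ (z = x ∨ z = t) := by grind
    have e4 : ¬ (z = x ∨ z = t') := by grind
    have e5 : ¬ (z = v ∨ z = p') := by grind
    simpa only [e1, e2, e3, e4, e5, if_false, Nat.add_zero, Nat.le_zero] using this
  have hpA : dg A p = 2 := by
    rw [dA]; simp [*, eq_comm]
  have hpB : dg B p = 0 := by
    have := dB p
    have e1 : ¬ (p = u ∨ p = y) := by grind
    have e2 : ¬ (p = v ∨ p = x') := by grind
    have e3 : ¬ (p = x ∨ p = t) := by grind
    have e4 : ¬ (p = x ∨ p = t') := by grind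
    have e5 : ¬ (p = v ∨ p = p') := by grind
    simpa only [e1, e2, e3, e4, e5, if_false, Nat.add_zero, Nat.le_zero] using this
  have hgd : ∀ g ∈ ({x, v} : Finset V), dg B g + 1 ≤ dg A g := by
    have hxA : dg A x = 3 := by
      rw [dA]; simp [*, eq_comm]
    have hvA : dg A v = 3 := by
      rw [dA]
      have e1 : ¬ (v = x ∨ v = y) := by grind
      have e2 : ¬ (v = x ∨ v = z) := by grind
      have e3 : ¬ (v = p ∨ v = z) := by grind
      simp [e1, e2, e3]
    have hxB : dg B x ≤ 2 := by
      have := dB x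
      have e1 : ¬ (x = u ∨ x = y) := by grind
      have e2 : ¬ (x = v ∨ x = x') := by grind
      have e5 : ¬ (x = v ∨ x = p') := by grind
      simpa [e1, e2, e5] using this
    have hvB : dg B v ≤ 2 := by
      have := dB v
      have e1 : ¬ (v = u ∨ v = y) := by grind
      have e2 : ¬ (v = x ∨ v = t) := by grind
      have e5 : ¬ (v = x ∨ v = t') := by grind
      simpa [e1, e2, e5] using this
    intro g hg
    simp only [Finset.mem_insert, Finset.mem_singleton] at hg
    rcases hg with rfl | rfl <;> omega
  have hfree : ∀ w, w ∉ ({x, v} : Finset V) → w ≠ p → w ≠ z →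
      dg B w + fg H.E {x, v} A B w < 2 := by
    intro w hw hwp hwz
    simp only [Finset.mem_insert, Finset.mem_singleton, not_or] at hw
    have h2 := dB w
    have h3 : fg H.E {x, v} A B w = (if s(x, w) ∈ fr H.E A B then 1 else 0) +
        (if s(v, w) ∈ fr H.E A B then 1 else 0) := by
      unfold fg
      rw [Finset.filter_insert, Finset.filter_singleton]
      split_ifs <;> simp [hxv]
    rw [h3]
    by_cases hsw : H.side w = b
    · have n1 : s(x, w) ∉ fr H.E A B := by
        rw [mem_fr, H.hEm, hx, hsw]; simp
      have n2 : w = u ∨ w = x' ∨ w = p' → s(v, w) ∉ fr H.E A B := by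
        rw [mem_fr, hA, hB]
        rintro (h | h | h) <;> simp [h]
      have d1 := hLR _ _ hsw hy
      have d2 := hLR _ _ hsw ht
      have d3 := hLR _ _ hsw ht'
      have d4 := hw.1
      have d5 := hw.2
      simp only [d1, d2, d3, d4, d5, or_false, false_or, if_false] at h2
      rw [if_neg n1]
      clear dA dB hA hB hgg h3 hgd hLR pos
      by_cases q1 : w = u
      · have q2 : w ≠ x' := q1 ▸ l2
        have q3 : w ≠ p' := q1 ▸ l4
        rw [if_neg (n2 (Or.inl q1))]
        simp only [q1, l2, l4, if_true, if_false] at h2 ⊢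
        omega
      by_cases q2 : w = x'
      · have q3 : w ≠ p' := q2 ▸ l9
        rw [if_neg (n2 (Or.inr (Or.inl q2)))]
        simp only [q1, q2, q3, if_true, if_false] at h2 ⊢
        grind
      by_cases q3 : w = p'
      · rw [if_neg (n2 (Or.inr (Or.inr q3)))]
        simp only [q1, q2, if_false] at h2 ⊢
        grind
      · simp only [q1, q2, q3, if_false] at h2
        split_ifs <;> omega
    · have hsw' : H.side w = !b := by
        cases b <;> simpa using hsw
      have n1 : s(v, w) ∉ fr H.E A B := by
        rw [mem_fr, H.hEm, hv, hsw']; simp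
      have n2 : w = y ∨ w = t ∨ w = t' → s(x, w) ∉ fr H.E A B := by
        rw [mem_fr, hA, hB]
        rintro (h | h | h) <;> simp [h]
      have d1 := (hLR _ _ hu hsw').symm
      have d2 := (hLR _ _ hx' hsw').symm
      have d3 := (hLR _ _ hp' hsw').symm
      have d4 := hw.1
      have d5 := hw.2
      simp only [d1, d2, d3, d4, d5, false_or, if_false] at h2
      rw [if_neg n1]
      clear dA dB hA hB hgg h3 hgd hLR pos
      by_cases q1 : w = y
      · have q2 : w ≠ t := q1 ▸ r6
        have q3 : w ≠ t' := q1 ▸ r7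
        rw [if_neg (n2 (Or.inl q1))]
        simp only [q1, r6, r7, if_true, if_false] at h2 ⊢
        omega
      by_cases q2 : w = t
      · rw [if_neg (n2 (Or.inr (Or.inl q2)))]
        grind
      by_cases q3 : w = t'
      · rw [if_neg (n2 (Or.inr (Or.inr q3)))]
        grind
      · simp only [q1, q2, q3, if_false] at h2
        split_ifs <;> omega
  have P1 : Pre H.E H.m p {x, v} A B := by
    refine ⟨pos, by omega, by omega, ?_, hgg, hgd, ?_⟩
    · intro g hg
      simp only [Finset.mem_insert, Finset.mem_singleton] at hg
      rw [mem_fr, H.hEm]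
      rcases hg with rfl | rfl
      · simp [hx, hp]; grind
      · refine ⟨(hLR _ _ hp hv).symm, ?_⟩
        simp [hA]
    · intro w hw hwp
      by_cases hwz : w = z
      · subst hwz
        have h3 : fg H.E {x, v} A B w = 0 := by
          unfold fg
          rw [Finset.card_eq_zero, Finset.filter_eq_empty_iff]
          intro g hg
          simp only [Finset.mem_insert, Finset.mem_singleton] at hg
          rw [mem_fr, H.hEm]
          rcases hg with rfl | rfl
          · simp [hA]
          · simp [hv, hz]
        omega
      · rw [hpA]; exact hfree w hw hwp hwz
  have P2 : Pre H.E H.m z {x, v} A B := by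
    refine ⟨pos, by omega, by omega, ?_, hgg, hgd, ?_⟩
    · intro g hg
      simp only [Finset.mem_insert, Finset.mem_singleton] at hg
      rw [mem_fr, H.hEm]
      rcases hg with rfl | rfl
      · refine ⟨hLR _ _ hx hz, ?_⟩
        simp [hA]
      · simp [hv, hz]; grind
    · intro w hw hwz
      by_cases hwp : w = p
      · subst hwp
        have h3 : fg H.E {x, v} A B w = 0 := by
          unfold fg
          rw [Finset.card_eq_zero, Finset.filter_eq_empty_iff]
          intro g hg
          simp only [Finset.mem_insert, Finset.mem_singleton] at hg
          rw [mem_fr, H.hEm]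
          rcases hg with rfl | rfl
          · simp [hx, hp]
          · simp [hA]
        omega
      · rw [hzA]; exact hfree w hw hwp hwz
  refine P1.threat hm H.hE ?_
  intro w hw
  refine P2.decline hm H.hE hw ?_
  intro hzw
  rw [Sym2.mem_iff] at hzw
  rcases hzw with h | h
  · exact hLR _ _ hp hz h.symm
  · subst h
    rw [mem_fr] at hw
    exact hw.2.1 (by simp [hA])

theorem stage5 (H : Host V) {u x x' p v y z t t' : V} {b : Bool}
    (hu : H.side u = b) (hx : H.side x = b) (hx' : H.side x' = b) (hp : H.side p = b)
    (hv : H.side v = !b) (hy : H.side y = !b) (hz : H.side z = !b)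
    (ht : H.side t = !b) (ht' : H.side t' = !b)
    (hL : [u, x, x', p].Nodup) (hR : [v, y, z, t, t'].Nodup)
    (pos : Pos H.E {s(v, p), s(x, z), s(x, y), s(v, x), s(u, v)}
      {s(x, t'), s(x, t), s(v, x'), s(u, y)}) :
    BW H.E H.m {s(v, p), s(x, z), s(x, y), s(v, x), s(u, v)}
      {s(x, t'), s(x, t), s(v, x'), s(u, y)} := by
  have hm := H.hm
  have hLR : ∀ a c, H.side a = b → H.side c = !b → a ≠ c := by
    intro a c h1 h2 h3
    subst h3
    rw [h1] at h2
    cases b <;> simp at h2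
  have dA : ∀ w, dg {s(v, p), s(x, z), s(x, y), s(v, x), s(u, v)} w =
      (((((0 + if w ∈ s(u, v) then 1 else 0) + if w ∈ s(v, x) then 1 else 0)
      + if w ∈ s(x, y) then 1 else 0) + if w ∈ s(x, z) then 1 else 0)
      + if w ∈ s(v, p) then 1 else 0) := by
    intro w
    rw [dg_insert, dg_insert, dg_insert, dg_insert, ← insert_empty_eq, dg_insert,
      dg_empty]
    all_goals
      simp only [Finset.mem_insert, Finset.mem_singleton, Finset.notMem_empty, Sym2.eq_iff,
        not_false_eq_true]
      try grind
  have dB : ∀ w, dg {s(x, t'), s(x, t), s(v, x'), s(u, y)} w ≤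
      ((((0 + if w ∈ s(u, y) then 1 else 0) + if w ∈ s(v, x') then 1 else 0)
      + if w ∈ s(x, t) then 1 else 0) + if w ∈ s(x, t') then 1 else 0) := by
    intro w
    refine (dg_insert_le _ _ _).trans (Nat.add_le_add_right ?_ _)
    refine (dg_insert_le _ _ _).trans (Nat.add_le_add_right ?_ _)
    refine (dg_insert_le _ _ _).trans (Nat.add_le_add_right ?_ _)
    rw [← insert_empty_eq]
    refine (dg_insert_le _ _ _).trans (Nat.add_le_add_right ?_ _)
    rw [dg_empty]
  simp only [Sym2.mem_iff] at dA dB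
  have hcA : dg {s(v, p), s(x, z), s(x, y), s(v, x), s(u, v)} v = 3 := by rw [dA]; grind
  refine Pre.threat hm H.hE (Pre.simple (c := v) pos ?_ (by omega) ?_) ?_
  · rw [hcA]; have := dB v; grind
  · intro w hw
    rw [hcA]; have := dB w; grind
  · intro w hw
    have hw' := mem_fr.1 hw
    rw [H.hEm] at hw'
    simp only [Finset.mem_insert, Finset.mem_singleton, Sym2.eq_iff] at hw'
    have hsw : H.side w = b := by
      have := hw'.1
      rw [hv] at this
      cases b <;> cases hq : H.side w <;> simp_all
    have hpos := pos.insB hw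
    have hfree : s(p, z) ∈ fr H.E {s(v, p), s(x, z), s(x, y), s(v, x), s(u, v)}
      {s(v, w), s(x, t'), s(x, t), s(v, x'), s(u, y)} := by
      rw [mem_fr, H.hEm, hp, hz]
      simp only [Finset.mem_insert, Finset.mem_singleton, Sym2.eq_iff]
      refine ⟨by simp, ?_, ?_⟩ <;> grind
    refine AW.of_BW hfree ?_
    exact stage6 H hu hx hx' hp hsw hv hy hz ht ht' (by grind) (by grind) (hpos.insA hfree)

theorem stage4 (H : Host V) {u x x' v y z t : V} {b : Bool}
    (hu : H.side u = b) (hx : H.side x = b) (hx' : H.side x' = b)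
    (hv : H.side v = !b) (hy : H.side y = !b) (hz : H.side z = !b)
    (ht : H.side t = !b)
    (hL : [u, x, x'].Nodup) (hR : [v, y, z, t].Nodup)
    (pos : Pos H.E {s(x, z), s(x, y), s(v, x), s(u, v)}
      {s(x, t), s(v, x'), s(u, y)}) :
    BW H.E H.m {s(x, z), s(x, y), s(v, x), s(u, v)}
      {s(x, t), s(v, x'), s(u, y)} := by
  have hm := H.hm
  have hLR : ∀ a c, H.side a = b → H.side c = !b → a ≠ c := by
    intro a c h1 h2 h3
    subst h3
    rw [h1] at h2
    cases b <;> simp at h2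
  have dA : ∀ w, dg {s(x, z), s(x, y), s(v, x), s(u, v)} w =
      ((((0 + if w ∈ s(u, v) then 1 else 0) + if w ∈ s(v, x) then 1 else 0)
      + if w ∈ s(x, y) then 1 else 0) + if w ∈ s(x, z) then 1 else 0) := by
    intro w
    rw [dg_insert, dg_insert, dg_insert, ← insert_empty_eq, dg_insert, dg_empty]
    all_goals
      simp only [Finset.mem_insert, Finset.mem_singleton, Finset.notMem_empty, Sym2.eq_iff,
        not_false_eq_true]
      try grind
  have dB : ∀ w, dg {s(x, t), s(v, x'), s(u, y)} w ≤
      (((0 + if w ∈ s(u, y) then 1 else 0) + if w ∈ s(v, x') then 1 else 0)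
      + if w ∈ s(x, t) then 1 else 0) := by
    intro w
    refine (dg_insert_le _ _ _).trans (Nat.add_le_add_right ?_ _)
    refine (dg_insert_le _ _ _).trans (Nat.add_le_add_right ?_ _)
    rw [← insert_empty_eq]
    refine (dg_insert_le _ _ _).trans (Nat.add_le_add_right ?_ _)
    rw [dg_empty]
  simp only [Sym2.mem_iff] at dA dB
  have hcA : dg {s(x, z), s(x, y), s(v, x), s(u, v)} x = 3 := by rw [dA]; grind
  refine Pre.threat hm H.hE (Pre.simple (c := x) pos ?_ (by omega) ?_) ?_
  · rw [hcA]; have := dB x; grind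
  · intro w hw
    rw [hcA]; have := dB w; grind
  · intro w hw
    have hw' := mem_fr.1 hw
    rw [H.hEm] at hw'
    simp only [Finset.mem_insert, Finset.mem_singleton, Sym2.eq_iff] at hw'
    have hsw : H.side w = !b := by
      have := hw'.1
      rw [hx] at this
      cases b <;> cases hq : H.side w <;> simp_all
    have hpos := pos.insB hw
    obtain ⟨p, hp, hpS⟩ := H.hfresh b {u, x, x'} (by
      have := Finset.card_le_three (a := u) (b := x) (c := x'); omega)
    simp only [Finset.mem_insert, Finset.mem_singleton] at hpS
    have hfree : s(v, p) ∈ fr H.E {s(x, z), s(x, y), s(v, x), s(u, v)}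
      {s(x, w), s(x, t), s(v, x'), s(u, y)} := by
      rw [mem_fr, H.hEm, hp, hv]
      simp only [Finset.mem_insert, Finset.mem_singleton, Sym2.eq_iff]
      refine ⟨by simp, ?_, ?_⟩ <;> grind
    refine AW.of_BW hfree ?_
    exact stage5 H hu hx hx' hp hv hy hz ht hsw (by grind) (by grind) (hpos.insA hfree)

theorem stage3 (H : Host V) {u x x' v y : V} {b : Bool}
    (hu : H.side u = b) (hx : H.side x = b) (hx' : H.side x' = b)
    (hv : H.side v = !b) (hy : H.side y = !b)
    (hL : [u, x, x'].Nodup) (hR : [v, y].Nodup)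
    (pos : Pos H.E {s(x, y), s(v, x), s(u, v)} {s(v, x'), s(u, y)}) :
    BW H.E H.m {s(x, y), s(v, x), s(u, v)} {s(v, x'), s(u, y)} := by
  have hm := H.hm
  have hLR : ∀ a c, H.side a = b → H.side c = !b → a ≠ c := by
    intro a c h1 h2 h3
    subst h3
    rw [h1] at h2
    cases b <;> simp at h2
  have dA : ∀ w, dg {s(x, y), s(v, x), s(u, v)} w =
      (((0 + if w ∈ s(u, v) then 1 else 0) + if w ∈ s(v, x) then 1 else 0)
      + if w ∈ s(x, y) then 1 else 0) := by
    intro w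
    rw [dg_insert, dg_insert, ← insert_empty_eq, dg_insert, dg_empty]
    all_goals
      simp only [Finset.mem_insert, Finset.mem_singleton, Finset.notMem_empty, Sym2.eq_iff,
        not_false_eq_true]
      try grind
  have dB : ∀ w, dg {s(v, x'), s(u, y)} w ≤
      ((0 + if w ∈ s(u, y) then 1 else 0) + if w ∈ s(v, x') then 1 else 0) := by
    intro w
    refine (dg_insert_le _ _ _).trans (Nat.add_le_add_right ?_ _)
    rw [← insert_empty_eq]
    refine (dg_insert_le _ _ _).trans (Nat.add_le_add_right ?_ _)
    rw [dg_empty]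
  simp only [Sym2.mem_iff] at dA dB
  have hcA : dg {s(x, y), s(v, x), s(u, v)} x = 2 := by rw [dA]; grind
  refine Pre.threat hm H.hE (Pre.simple (c := x) pos ?_ (by omega) ?_) ?_
  · rw [hcA]; have := dB x; grind
  · intro w hw
    rw [hcA]; have := dB w; grind
  · intro w hw
    have hw' := mem_fr.1 hw
    rw [H.hEm] at hw'
    simp only [Finset.mem_insert, Finset.mem_singleton, Sym2.eq_iff] at hw'
    have hsw : H.side w = !b := by
      have := hw'.1
      rw [hx] at this
      cases b <;> cases hq : H.side w <;> simp_all
    have hpos := pos.insB hw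
    obtain ⟨z, hz, hzS⟩ := H.hfresh (!b) {v, y, w} (by
      have := Finset.card_le_three (a := v) (b := y) (c := w); omega)
    simp only [Finset.mem_insert, Finset.mem_singleton] at hzS
    have hfree : s(x, z) ∈ fr H.E {s(x, y), s(v, x), s(u, v)}
      {s(x, w), s(v, x'), s(u, y)} := by
      rw [mem_fr, H.hEm, hx, hz]
      simp only [Finset.mem_insert, Finset.mem_singleton, Sym2.eq_iff]
      refine ⟨by simp, ?_, ?_⟩ <;> grind
    refine AW.of_BW hfree ?_
    exact stage4 H hu hx hx' hv hy hz hsw (by grind) (by grind) (hpos.insA hfree)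

theorem stage2 (H : Host V) {u x v y : V} {b : Bool}
    (hu : H.side u = b) (hx : H.side x = b)
    (hv : H.side v = !b) (hy : H.side y = !b)
    (hL : u ≠ x) (hR : v ≠ y)
    (pos : Pos H.E {s(v, x), s(u, v)} {s(u, y)}) :
    BW H.E H.m {s(v, x), s(u, v)} {s(u, y)} := by
  have hm := H.hm
  have hLR : ∀ a c, H.side a = b → H.side c = !b → a ≠ c := by
    intro a c h1 h2 h3
    subst h3
    rw [h1] at h2
    cases b <;> simp at h2
  have dA : ∀ w, dg {s(v, x), s(u, v)} w =
      ((0 + if w ∈ s(u, v) then 1 else 0) + if w ∈ s(v, x) then 1 else 0) := by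
    intro w
    rw [dg_insert, ← insert_empty_eq, dg_insert, dg_empty]
    all_goals
      simp only [Finset.mem_singleton, Finset.notMem_empty, Sym2.eq_iff,
        not_false_eq_true]
      try grind
  have dB : ∀ w, dg {s(u, y)} w ≤ (0 + if w ∈ s(u, y) then 1 else 0) := by
    intro w
    rw [← insert_empty_eq]
    refine (dg_insert_le _ _ _).trans (Nat.add_le_add_right ?_ _)
    rw [dg_empty]
  simp only [Sym2.mem_iff] at dA dB
  have hcA : dg {s(v, x), s(u, v)} v = 2 := by rw [dA]; grind
  refine Pre.threat hm H.hE (Pre.simple (c := v) pos ?_ (by omega) ?_) ?_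
  · rw [hcA]; have := dB v; grind
  · intro w hw
    rw [hcA]; have := dB w; grind
  · intro w hw
    have hw' := mem_fr.1 hw
    rw [H.hEm] at hw'
    simp only [Finset.mem_insert, Finset.mem_singleton, Sym2.eq_iff] at hw'
    have hsw : H.side w = b := by
      have := hw'.1
      rw [hv] at this
      cases b <;> cases hq : H.side w <;> simp_all
    have hpos := pos.insB hw
    have hfree : s(x, y) ∈ fr H.E {s(v, x), s(u, v)} {s(v, w), s(u, y)} := by
      rw [mem_fr, H.hEm, hx, hy]
      simp only [Finset.mem_insert, Finset.mem_singleton, Sym2.eq_iff]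
      refine ⟨by simp, ?_, ?_⟩ <;> grind
    refine AW.of_BW hfree ?_
    exact stage3 H hu hx hsw hv hy (by grind) (by grind) (hpos.insA hfree)

/-- Bob's first edge meets Alice's first edge. -/
lemma stage1a (H : Host V) {u v y : V} {b : Bool}
    (hu : H.side u = b) (hv : H.side v = !b) (hy : H.side y = !b) (hR : v ≠ y)
    (pos : Pos H.E {s(u, v)} {s(u, y)}) : AW H.E H.m {s(u, v)} {s(u, y)} := by
  obtain ⟨x, hx, hxS⟩ := H.hfresh b {u} (by simp)
  rw [Finset.mem_singleton] at hxS
  have hxv : x ≠ v := by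
    rintro rfl
    rw [hx] at hv
    cases b <;> simp at hv
  have huv : u ≠ v := by
    rintro rfl
    rw [hu] at hv
    cases b <;> simp at hv
  have hfree : s(v, x) ∈ fr H.E {s(u, v)} {s(u, y)} := by
    rw [mem_fr, H.hEm, hv, hx]
    simp only [Finset.mem_singleton, Sym2.eq_iff]
    refine ⟨by simp, ?_, ?_⟩ <;> grind
  exact AW.of_BW hfree (stage2 H hu hx hv hy (Ne.symm hxS) hR (pos.insA hfree))

/-- Bob's first edge is disjoint from Alice's first edge. -/
lemma stage1b (H : Host V) {u v y x : V} {b : Bool}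
    (hu : H.side u = b) (hx : H.side x = b) (hv : H.side v = !b) (hy : H.side y = !b)
    (hL : u ≠ x) (hR : v ≠ y)
    (pos : Pos H.E {s(v, x)} {s(u, y)}) : AW H.E H.m {s(v, x)} {s(u, y)} := by
  have huv : u ≠ v := by
    rintro rfl
    rw [hu] at hv
    cases b <;> simp at hv
  have hfree : s(u, v) ∈ fr H.E {s(v, x)} {s(u, y)} := by
    rw [mem_fr, H.hEm, hv, hu]
    simp only [Finset.mem_singleton, Sym2.eq_iff]
    refine ⟨by simp, ?_, ?_⟩ <;> grind
  have hpos := pos.insA hfree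
  refine AW.of_BW hfree ?_
  rw [show insert s(u, v) {s(v, x)} = ({s(v, x), s(u, v)} : Finset (Sym2 V)) from
    Finset.pair_comm _ _] at hpos ⊢
  exact stage2 H hu hx hv hy hL hR hpos

theorem stage0 (H : Host V) : AW H.E H.m ∅ ∅ := by
  obtain ⟨a, ha, -⟩ := H.hfresh true ∅ (by simp)
  obtain ⟨c, hc, -⟩ := H.hfresh false ∅ (by simp)
  have pos0 : Pos H.E ∅ ∅ := ⟨by simp, by simp, by simp⟩
  have hfree : s(a, c) ∈ fr H.E ∅ ∅ := by
    rw [mem_fr, H.hEm, ha, hc]; simp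
  have pos1 : Pos H.E {s(a, c)} ∅ := pos0.insA hfree
  refine AW.of_BW hfree ?_
  refine ⟨?_, ?_⟩
  · obtain ⟨a', ha', haS⟩ := H.hfresh true {a} (by simp)
    refine ⟨s(a', c), ?_⟩
    rw [mem_fr, H.hEm, ha', hc]
    simp only [Finset.mem_singleton] at haS
    simp [haS]
    grind
  · intro f hf
    have hcase : ∃ d e, H.side d = true ∧ H.side e = false ∧ f = s(d, e) := by
      induction f using Sym2.ind with
      | _ d e =>
        have h1 := (mem_fr.1 hf).1
        rw [H.hEm] at h1
        cases hd : H.side d <;> cases he : H.side e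
        · simp [hd, he] at h1
        · exact ⟨e, d, he, hd, Sym2.eq_swap⟩
        · exact ⟨d, e, hd, he, rfl⟩
        · simp [hd, he] at h1
    obtain ⟨d, e, hd, he, rfl⟩ := hcase
    have pos2 : Pos H.E {s(a, c)} {s(d, e)} := pos1.insB hf
    have hne : s(d, e) ≠ s(a, c) := by
      have := (mem_fr.1 hf).2.1
      simpa using this
    change AW H.E H.m {s(a, c)} {s(d, e)}
    by_cases h1 : d = a
    · subst h1
      refine stage1a H (b := true) hd hc he ?_ pos2
      rintro rfl
      exact hne rfl
    by_cases h2 : e = c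
    · subst h2
      rw [Sym2.eq_swap (a := a), Sym2.eq_swap (a := d)] at pos2 ⊢
      exact stage1a H (b := false) he ha hd (Ne.symm h1) pos2
    · rw [Sym2.eq_swap (a := a)] at pos2 ⊢
      exact stage1b H (b := true) hd ha hc he h1 (Ne.symm h2) pos2

end Stages

end AchievementGame

namespace AchievementGame

section Transfer

variable {V : Type} [DecidableEq V] [Fintype V]

lemma dg_eq_card (S : Finset (Sym2 V)) (v : V) :
    dg S v = (Finset.univ.filter (fun w => s(v, w) ∈ S)).card := by
  unfold dg
  rw [← Finset.card_image_of_injective (f := fun w => s(v, w))]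
  · congr 1
    ext e
    simp only [Finset.mem_filter, Finset.mem_image, Finset.mem_univ, true_and]
    constructor
    · rintro ⟨h1, w, rfl⟩
      exact ⟨w, h1, rfl⟩
    · rintro ⟨w, h1, rfl⟩
      exact ⟨h1, by simp⟩
  · intro a b h
    exact Sym2.congr_right.1 h

lemma hasCopy_of_dg {S : Finset (Sym2 V)} {m : ℕ} (hS : ∀ w, s(w, w) ∉ S) {v : V}
    (h : m ≤ dg S v) : HasCopy (star m) (S : Set (Sym2 V)) := by
  rw [dg_eq_card] at h
  have hc : Fintype.card (Fin m) ≤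
      Fintype.card (Finset.univ.filter (fun w => s(v, w) ∈ S)) := by
    rw [Fintype.card_fin, Fintype.card_coe]; exact h
  obtain ⟨g⟩ := Function.Embedding.nonempty_of_card_le hc
  have hg : ∀ i, s(v, (g i : V)) ∈ S := fun i => by
    have := (g i).2
    rw [Finset.mem_filter] at this
    exact this.2
  refine ⟨⟨Fin.cons v (fun i => (g i : V)), ?_⟩, ?_⟩
  · rw [Fin.cons_injective_iff]
    refine ⟨?_, ?_⟩
    · rintro ⟨i, hi⟩
      have := hg i
      simp only at hi
      rw [hi] at this
      exact hS _ this
    · intro i j hij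
      exact g.injective (Subtype.ext hij)
  · intro a b hab
    unfold star at hab
    rw [SimpleGraph.fromRel_adj] at hab
    obtain ⟨hne, h0 | h0⟩ := hab
    · subst h0
      obtain ⟨j, rfl⟩ := Fin.exists_succ_eq.2 (Ne.symm hne)
      simpa using hg j
    · subst h0
      obtain ⟨j, rfl⟩ := Fin.exists_succ_eq.2 hne
      rw [Sym2.eq_swap]
      simpa using hg j

lemma dg_of_hasCopy {S : Finset (Sym2 V)} {m : ℕ}
    (h : HasCopy (star m) (S : Set (Sym2 V))) : ∃ v, m ≤ dg S v := by
  obtain ⟨f, hf⟩ := h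
  refine ⟨f 0, ?_⟩
  rw [dg_eq_card]
  have : (Finset.univ : Finset (Fin m)).card ≤
      (Finset.univ.filter (fun w => s(f 0, w) ∈ S)).card := by
    apply Finset.card_le_card_of_injOn (fun i => f i.succ)
    · intro i _
      simp only [Finset.coe_filter, Finset.mem_univ, true_and, Set.mem_setOf_eq]
      have := hf 0 i.succ (by
        unfold star
        rw [SimpleGraph.fromRel_adj]
        exact ⟨(Fin.succ_ne_zero i).symm, Or.inl rfl⟩)
      simpa using this
    · intro i _ j _ hij
      exact Fin.succ_injective _ (f.injective hij)
  simpa using this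

lemma HasCopy.mono {β : Type} {F : SimpleGraph β} {s t : Set (Sym2 V)} (h : s ⊆ t)
    (hs : HasCopy F s) : HasCopy F t := by
  obtain ⟨f, hf⟩ := hs
  exact ⟨f, fun a b hab => h (hf a b hab)⟩

/-- Adding one move to a position. -/
def addMove (q : Finset (Sym2 V) × Finset (Sym2 V) × Bool) (e : Sym2 V) :
    Finset (Sym2 V) × Finset (Sym2 V) × Bool :=
  if q.2.2 then (insert e q.1, q.2.1, false) else (q.1, insert e q.2.1, true)

/-- The position reached after a list of moves. -/
def pst (l : List (Sym2 V)) : Finset (Sym2 V) × Finset (Sym2 V) × Bool :=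
  l.foldl addMove (∅, ∅, true)

lemma pst_append (l : List (Sym2 V)) (e : Sym2 V) : pst (l ++ [e]) = addMove (pst l) e := by
  simp [pst]

lemma mem_pst (l : List (Sym2 V)) (e : Sym2 V) :
    e ∈ l ↔ e ∈ (pst l).1 ∨ e ∈ (pst l).2.1 := by
  induction l using List.reverseRecOn with
  | nil => simp [pst]
  | append_singleton l a ih =>
    rw [pst_append, List.mem_append, List.mem_singleton, ih]
    unfold addMove
    split_ifs <;> simp only [Finset.mem_insert] <;> tauto

/-- A good move for Alice. -/
def Good (E : Finset (Sym2 V)) (m : ℕ) (A B : Finset (Sym2 V)) (e : Sym2 V) : Prop :=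
  e ∈ fr E A B ∧ (((∃ v, m ≤ dg (insert e A) v) ∧ ∀ v, dg B v < m) ∨ BW E m (insert e A) B)

lemma AW.good {E : Finset (Sym2 V)} {m : ℕ} {A B : Finset (Sym2 V)} (h : AW E m A B) :
    ∃ e, Good E m A B e := by
  cases h with
  | now _ _ e he h1 h2 => exact ⟨e, he, Or.inl ⟨h1, h2⟩⟩
  | step _ _ e he h0 h => exact ⟨e, he, Or.inr ⟨h0, h⟩⟩

open Classical in
/-- Alice's strategy. -/
noncomputable def strat (E : Finset (Sym2 V)) (m : ℕ) (e0 : Sym2 V) : Strategy V := fun l =>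
  if h : ∃ e, Good E m (pst l).1 (pst l).2.1 e then h.choose
  else if h : ∃ e, e ∈ fr E (pst l).1 (pst l).2.1 then h.choose else e0

lemma strat_good {E : Finset (Sym2 V)} {m : ℕ} {e0 : Sym2 V} (l : List (Sym2 V))
    (h : ∃ e, Good E m (pst l).1 (pst l).2.1 e) :
    Good E m (pst l).1 (pst l).2.1 (strat E m e0 l) := by
  unfold strat
  rw [dif_pos h]
  exact h.choose_spec

theorem aliceWins_of_AW {G : SimpleGraph V} {E : Finset (Sym2 V)} {m : ℕ}
    (hG : ∀ e, e ∈ G.edgeSet ↔ e ∈ E) (e0 : Sym2 V) (h : AW E m ∅ ∅) :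
    AliceWins (star m) G := by
  refine ⟨strat E m e0, ?_, ?_⟩
  · rintro l ⟨e, he, hel⟩
    rw [mem_pst, not_or] at hel
    have hex : ∃ e, e ∈ fr E (pst l).1 (pst l).2.1 :=
      ⟨e, mem_fr.2 ⟨(hG e).1 he, hel.1, hel.2⟩⟩
    have key : strat E m e0 l ∈ fr E (pst l).1 (pst l).2.1 := by
      unfold strat
      split_ifs with h1
      · exact h1.choose_spec.1
      · exact hex.choose_spec
    rw [mem_fr] at key
    rw [hG, mem_pst, not_or]
    exact key
  · intro τ hτ
    set σ := strat E m e0 with hσ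
    have hcard : G.edgeSet.ncard = E.card := by
      have : G.edgeSet = (E : Set (Sym2 V)) := by
        ext e; rw [hG]; rfl
      rw [this, Set.ncard_coe_finset]
    have hstep : ∀ n, pst (hist σ τ (n + 1)) = addMove (pst (hist σ τ n)) (move σ τ n) := by
      intro n
      rw [← pst_append]
      rfl
    have main : ∀ N k, (fr E (pst (hist σ τ (2 * k))).1 (pst (hist σ τ (2 * k))).2.1).card ≤ N →
        (pst (hist σ τ (2 * k))).2.2 = true →
        Pos E (pst (hist σ τ (2 * k))).1 (pst (hist σ τ (2 * k))).2.1 →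
        (pst (hist σ τ (2 * k))).1.card = k → (pst (hist σ τ (2 * k))).2.1.card = k →
        (∀ e ∈ (pst (hist σ τ (2 * k))).1, ∃ i < k, e = move σ τ (2 * i)) →
        (∀ i < k, move σ τ (2 * i + 1) ∈ (pst (hist σ τ (2 * k))).2.1) →
        AW E m (pst (hist σ τ (2 * k))).1 (pst (hist σ τ (2 * k))).2.1 →
        ∃ k : ℕ, 2 * k + 1 ≤ G.edgeSet.ncard ∧
          HasCopy (star m) {e | ∃ i ≤ k, e = move σ τ (2 * i)} ∧
          ¬ HasCopy (star m) {e | ∃ i < k, e = move σ τ (2 * i + 1)} := by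
      intro N
      induction N with
      | zero =>
        intro k hN _ _ _ _ _ _ hAW
        obtain ⟨e, he, -⟩ := hAW.good
        rw [Finset.card_eq_zero.1 (Nat.le_zero.1 hN)] at he
        simp at he
      | succ N ih =>
        intro k hN ht hP hAc hBc hAm hBm hAW
        have hs1 := hstep (2 * k)
        have hs2 := hstep (2 * k + 1)
        obtain ⟨⟨A, B, t⟩, hq⟩ : ∃ q, q = pst (hist σ τ (2 * k)) := ⟨_, rfl⟩
        have hgood : Good E m (pst (hist σ τ (2 * k))).1 (pst (hist σ τ (2 * k))).2.1
            (move σ τ (2 * k)) := by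
          have : move σ τ (2 * k) = σ (hist σ τ (2 * k)) := by
            unfold move
            rw [if_pos (by omega)]
          rw [this]
          exact strat_good _ hAW.good
        rw [← hq] at hN ht hP hAc hBc hAm hBm hAW hs1 hgood
        simp only at hN ht hP hAc hBc hAm hBm hAW hgood
        subst ht
        obtain ⟨e, he⟩ : ∃ e, e = move σ τ (2 * k) := ⟨_, rfl⟩
        rw [← he] at hs1 hgood
        obtain ⟨hfr, hwin⟩ := hgood
        have hP1 := hP.insA hfr
        have hfr' := mem_fr.1 hfr
        rcases hwin with ⟨⟨v, hv⟩, hB⟩ | hBW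
        · refine ⟨k, ?_, ?_, ?_⟩
          · rw [hcard]
            have h1 : (insert e A ∪ B).card = k + 1 + k := by
              rw [Finset.card_union_of_disjoint hP1.hd, Finset.card_insert_of_notMem hfr'.2.1,
                hAc, hBc]
            have h2 := Finset.card_le_card (Finset.union_subset hP1.hA hP1.hB)
            omega
          · refine HasCopy.mono ?_ (hasCopy_of_dg (S := insert e A) ?_ hv)
            · intro e' he'
              rw [Finset.mem_coe, Finset.mem_insert] at he'
              rcases he' with rfl | he'
              · exact ⟨k, le_rfl, he⟩
              · obtain ⟨i, hi, h'⟩ := hAm e' he'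
                exact ⟨i, hi.le, h'⟩
            · intro w hw
              have := (hG _).2 (hP1.hA hw)
              rw [SimpleGraph.mem_edgeSet] at this
              exact G.loopless.irrefl w this
          · intro hcopy
            have : HasCopy (star m) (B : Set (Sym2 V)) := by
              refine HasCopy.mono ?_ hcopy
              rintro e' ⟨i, hi, rfl⟩
              exact hBm i hi
            obtain ⟨v, hv⟩ := dg_of_hasCopy this
            have := hB v
            omega
        · have hs1' : pst (hist σ τ (2 * k + 1)) = (insert e A, B, false) := by
            rw [hs1]; simp [addMove]
          obtain ⟨f, hf⟩ : ∃ f, f = move σ τ (2 * k + 1) := ⟨_, rfl⟩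
          have hs2' : pst (hist σ τ (2 * (k + 1))) = (insert e A, insert f B, true) := by
            rw [show 2 * (k + 1) = 2 * k + 1 + 1 by ring, hs2, hs1', hf]
            simp [addMove]
          have hffr : f ∈ fr E (insert e A) B := by
            have hmv : f = τ (hist σ τ (2 * k + 1)) := by
              rw [hf]
              unfold move
              rw [if_neg (by omega)]
            obtain ⟨f', hf'⟩ := hBW.1
            have hf'' := mem_fr.1 hf'
            have := hτ (hist σ τ (2 * k + 1)) ⟨f', (hG _).2 hf''.1, by
              rw [mem_pst, hs1']
              simp only
              tauto⟩
            rw [← hmv, hG, mem_pst, hs1', not_or] at this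
            exact mem_fr.2 this
          have hffr' := mem_fr.1 hffr
          have hlt : (fr E (insert e A) (insert f B)).card < (fr E A B).card := by
            apply Finset.card_lt_card
            refine ⟨fr_sub (Finset.subset_insert _ _) (Finset.subset_insert _ _), fun hcon => ?_⟩
            have := hcon hfr
            simp [mem_fr] at this
          have := ih (k + 1)
          rw [hs2'] at this
          refine this ?_ rfl (hP1.insB hffr) ?_ ?_ ?_ ?_ (hBW.2 f hffr)
          · simp only; omega
          · simp only
            rw [Finset.card_insert_of_notMem hfr'.2.1, hAc]
          · simp only
            rw [Finset.card_insert_of_notMem hffr'.2.2, hBc]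
          · intro e' he'
            simp only [Finset.mem_insert] at he'
            rcases he' with rfl | he'
            · exact ⟨k, by omega, he⟩
            · obtain ⟨i, hi, h'⟩ := hAm e' he'
              exact ⟨i, by omega, h'⟩
          · intro i hi
            simp only [Finset.mem_insert]
            rcases Nat.lt_succ_iff_lt_or_eq.1 hi with h' | rfl
            · right; exact hBm i h'
            · left; exact hf.symm
    refine main _ 0 le_rfl rfl ⟨?_, ?_, ?_⟩ rfl rfl ?_ ?_ ?_
    · simp [hist, pst]
    · simp [hist, pst]
    · simp [hist, pst]
    · simp [hist, pst]
    · simp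
    · simpa [hist, pst] using h

end Transfer

/-- The complete bipartite host. -/
lemma exists_host (m : ℕ) (hm : 4 ≤ m) :
    ∃ H : Host (Fin (2 * m - 3) ⊕ Fin (2 * m - 3)), H.m = m ∧
      ∀ e, e ∈ (completeBipartiteGraph (Fin (2 * m - 3)) (Fin (2 * m - 3))).edgeSet ↔ e ∈ H.E := by
  classical
  set n := 2 * m - 3 with hn
  set E : Finset (Sym2 (Fin n ⊕ Fin n)) :=
    Finset.univ.filter (fun e => e ∈ (completeBipartiteGraph (Fin n) (Fin n)).edgeSet) with hE
  have hmem : ∀ a b : Fin n ⊕ Fin n, s(a, b) ∈ E ↔ a.isLeft ≠ b.isLeft := by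
    intro a b
    rw [hE, Finset.mem_filter, SimpleGraph.mem_edgeSet]
    rcases a with a | a <;> rcases b with b | b <;> simp
  refine ⟨⟨Sum.isLeft, E, m, hm, hmem, ?_, ?_⟩, rfl, ?_⟩
  · intro v
    rw [dg_eq_card]
    simp only [hmem]
    rw [← hn]
    rcases v with v | v
    · have : (Finset.univ.filter (fun w : Fin n ⊕ Fin n =>
          (Sum.inl v : Fin n ⊕ Fin n).isLeft ≠ w.isLeft)) =
          (Finset.univ : Finset (Fin n)).image Sum.inr := by
        ext w
        rcases w with w | w <;> simp
      rw [this, Finset.card_image_of_injective _ Sum.inr_injective]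
      simp
    · have : (Finset.univ.filter (fun w : Fin n ⊕ Fin n =>
          (Sum.inr v : Fin n ⊕ Fin n).isLeft ≠ w.isLeft)) =
          (Finset.univ : Finset (Fin n)).image Sum.inl := by
        ext w
        rcases w with w | w <;> simp
      rw [this, Finset.card_image_of_injective _ Sum.inl_injective]
      simp
  · intro b S hS
    by_contra hcon
    push Not at hcon
    cases b
    · have hsub : (Finset.univ : Finset (Fin n)).image Sum.inr ⊆ S := by
        intro w hw
        rw [Finset.mem_image] at hw
        obtain ⟨i, -, rfl⟩ := hw
        exact hcon _ rfl
      have := Finset.card_le_card hsub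
      rw [Finset.card_image_of_injective _ Sum.inr_injective, Finset.card_univ,
        Fintype.card_fin] at this
      omega
    · have hsub : (Finset.univ : Finset (Fin n)).image Sum.inl ⊆ S := by
        intro w hw
        rw [Finset.mem_image] at hw
        obtain ⟨i, -, rfl⟩ := hw
        exact hcon _ rfl
      have := Finset.card_le_card hsub
      rw [Finset.card_image_of_injective _ Sum.inl_injective, Finset.card_univ,
        Fintype.card_fin] at this
      omega
  · intro e
    simp [hE]

end AchievementGame

open AchievementGame

/-- For every integer `m ≥ 4`, Alice has a winning strategy in the achievement game
`(K_{1,m}, K_{2m-3,2m-3}, +)` played on the complete bipartite graph with both parts of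
size `2m − 3`. -/
theorem stmt16 (m : ℕ) (hm : 4 ≤ m) :
    AliceWins (star m) (completeBipartiteGraph (Fin (2 * m - 3)) (Fin (2 * m - 3))) := by
  obtain ⟨H, hHm, hG⟩ := exists_host m hm
  have h := stage0 H
  rw [hHm] at h
  obtain ⟨a, -, -⟩ := H.hfresh true ∅ (by simp)
  exact aliceWins_of_AW hG s(a, a) h
end
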